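/- arXiv:1312.2259 — 4 statements merged into one kernel-verified Lean document; each statement's English description precedes it below -/
import Mathlib

section
/- Let v be a primitive invertible two-letter substitution sequence and fix 𝔮 ∈ ℝ. Then the Hausdorff dimension of the spectrum tends to zero in the decoupling limit: lim_{𝔭→0, 𝔭≠0} dim_H(Σ_{v,(𝔭,𝔮)}) = 0. -/
open Filter Topology

/-- Extension of a two-letter substitution (letters `false ↔ 0`, `true ↔ 1`)
to finite words by concatenation. -/
def applySubst (s : Bool → List Bool) (w : List Bool) : List Bool := w.flatMap s

/-- `substPow s k b` is the word `s^k(b)`. -/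
def substPow (s : Bool → List Bool) : ℕ → Bool → List Bool
  | 0, b => [b]
  | k + 1, b => applySubst s (substPow s k b)

/-- The image of a finite word in the free group on two letters. -/
def wordToFree (w : List Bool) : FreeGroup Bool := (w.map FreeGroup.of).prod

/-- A primitive invertible two-letter substitution. -/
structure IsPrimitiveInvertibleSubst (s : Bool → List Bool) : Prop where
  primitive : ∃ k : ℕ, ∀ b b' : Bool, b' ∈ substPow s k b
  invertible : ∃ φ : FreeGroup Bool ≃* FreeGroup Bool,
      ∀ b : Bool, φ (FreeGroup.of b) = wordToFree (s b)

/-- `w` is a prefix of the one-sided infinite sequence `u`. -/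
def SeqPrefix (w : List Bool) (u : ℕ → Bool) : Prop :=
  ∀ i : ℕ, ∀ h : i < w.length, w.get ⟨i, h⟩ = u i

/-- `u` is a fixed point of the substitution `s`: for each `m`, the word
`s(u 0)s(u 1)⋯s(u (m-1))` is a prefix of `u`. -/
def FixedPointOfSubst (s : Bool → List Bool) (u : ℕ → Bool) : Prop :=
  ∀ m : ℕ, SeqPrefix (applySubst s ((List.range m).map u)) u

/-- `v : ℤ → Bool` is the substitution sequence generated by the primitive invertible
substitution `s` (with `s(0)` beginning in `0`): a rotation sequence for some irrational
`α ∈ (0,1)` and phase `β`, whose restriction to `ℕ` is a fixed point of `s`. -/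
def IsSubstSeqOf (s : Bool → List Bool) (v : ℤ → Bool) : Prop :=
  IsPrimitiveInvertibleSubst s ∧ (s false).head? = some false ∧
    FixedPointOfSubst s (fun n : ℕ => v (n : ℤ)) ∧
    ∃ α β : ℝ, Irrational α ∧ α ∈ Set.Ioo (0 : ℝ) 1 ∧
      ∀ n : ℤ, (v n = true ↔ Int.fract ((n : ℝ) * α + β) ∈ Set.Ico (1 - α) 1)

/-- `v` is a primitive invertible two-letter substitution sequence. -/
def IsSubstSeq (v : ℤ → Bool) : Prop := ∃ s, IsSubstSeqOf s v

/-- The hull of `v`: limits in the product topology of left shifts `T^{n_i}(v)`, `n_i ↑ ∞`. -/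
def Hull (v : ℤ → Bool) : Set (ℤ → Bool) :=
  {ν | ∃ n : ℕ → ℕ, StrictMono n ∧ ∀ m : ℤ, ∀ᶠ i in atTop, v (m + (n i : ℤ)) = ν m}

noncomputable section

instance : Fact ((1 : ENNReal) ≤ 2) := ⟨one_le_two⟩

/-- The Hilbert space `ℓ²(ℤ, ℂ)`. -/
abbrev JacobiSpace : Type := lp (fun _ : ℤ => ℂ) 2

/-- Hopping coefficients: `p(0) = 1`, `p(1) = 𝔭`. -/
def pCoef (𝔭 : ℝ) (b : Bool) : ℝ := if b then 𝔭 else 1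

/-- Potential coefficients: `q(0) = 0`, `q(1) = 𝔮`. -/
def qCoef (𝔮 : ℝ) (b : Bool) : ℝ := if b then 𝔮 else 0

/-- `H` is the Jacobi operator with hopping `p ∘ ω` and potential `q ∘ ω`:
`(Hφ)_n = p(ω_{n+1}) φ_{n+1} + p(ω_n) φ_{n-1} + q(ω_n) φ_n`. -/
def IsJacobi (𝔭 𝔮 : ℝ) (ω : ℤ → Bool) (H : JacobiSpace →L[ℂ] JacobiSpace) : Prop :=
  ∀ φ : JacobiSpace, ∀ n : ℤ,
    (H φ : ∀ _ : ℤ, ℂ) n =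
      (pCoef 𝔭 (ω (n + 1)) : ℂ) * (φ : ∀ _ : ℤ, ℂ) (n + 1) +
      (pCoef 𝔭 (ω n) : ℂ) * (φ : ∀ _ : ℤ, ℂ) (n - 1) +
      (qCoef 𝔮 (ω n) : ℂ) * (φ : ∀ _ : ℤ, ℂ) n

/-- The spectrum of the Jacobi operator `H_{ω,(𝔭,𝔮)}`, regarded as a subset of `ℝ`. -/
def jacobiSpectrum (𝔭 𝔮 : ℝ) (ω : ℤ → Bool) : Set ℝ :=
  {E : ℝ | ∀ H : JacobiSpace →L[ℂ] JacobiSpace, IsJacobi 𝔭 𝔮 ω H → (E : ℂ) ∈ spectrum ℂ H}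

end

/-! ### Part 1: trace recursion along a run -/

/-- Values `t_0 = y`, `t_1 = x y - w`, `t_{n+2} = x t_{n+1} - t_n`. -/
def tseq (x y w : ℝ) : ℕ → ℝ
  | 0 => y
  | 1 => x * y - w
  | n + 2 => x * tseq x y w (n + 1) - tseq x y w n

/-- Formal derivative of `tseq`. -/
def dtseq (x y w x' y' w' : ℝ) : ℕ → ℝ
  | 0 => y'
  | 1 => x' * y + x * y' - w'
  | n + 2 => x' * tseq x y w (n + 1) + x * dtseq x y w x' y' w' (n + 1) - dtseq x y w x' y' w' n

lemma tseq_bound {x y w X Y : ℝ} (hx : |x| ≤ X) (hy : |y| ≤ Y) (hw : |w| ≤ Y) :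
    ∀ n, |tseq x y w n| ≤ Y * (X + 2) ^ n ∧ |tseq x y w (n + 1)| ≤ Y * (X + 2) ^ (n + 1) := by
  have hX : 0 ≤ X := (abs_nonneg _).trans hx
  have hY : 0 ≤ Y := (abs_nonneg _).trans hy
  intro n
  induction n with
  | zero =>
    refine ⟨by simpa [tseq] using hy, ?_⟩
    have h1 : |x * y - w| ≤ |x| * |y| + |w| := by
      rw [← abs_mul]; exact abs_sub _ _
    have h2 : |x| * |y| ≤ X * Y := mul_le_mul hx hy (abs_nonneg _) hX
    simp only [tseq, zero_add, pow_one]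
    nlinarith
  | succ n ih =>
    refine ⟨ih.2, ?_⟩
    have h1 : |tseq x y w (n + 1 + 1)| ≤ |x| * |tseq x y w (n + 1)| + |tseq x y w n| := by
      simp only [tseq]; rw [← abs_mul]; exact abs_sub _ _
    have h2 : |x| * |tseq x y w (n + 1)| ≤ X * (Y * (X + 2) ^ (n + 1)) :=
      mul_le_mul hx ih.2 (abs_nonneg _) hX
    have h3 : 0 ≤ Y * (X + 2) ^ n := by positivity
    have h4 : 0 ≤ X * (Y * (X + 2) ^ n) := by positivity
    have h5 := ih.1
    calc _ ≤ _ := h1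
      _ ≤ X * (Y * (X + 2) ^ (n + 1)) + Y * (X + 2) ^ n := by linarith
      _ ≤ _ := by
        rw [pow_succ (X + 2) (n + 1), pow_succ (X + 2) n]
        nlinarith

lemma dtseq_bound {x y w x' y' w' X Y : ℝ} (hx : |x| ≤ X) (hy : |y| ≤ Y) (hw : |w| ≤ Y)
    (hx' : |x'| ≤ 1) (hy' : |y'| ≤ Y) (hw' : |w'| ≤ Y) :
    ∀ n, |dtseq x y w x' y' w' n| ≤ Y * (X + 2) ^ n ∧
      |dtseq x y w x' y' w' (n + 1)| ≤ Y * (X + 2) ^ (n + 1) := by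
  have hX : 0 ≤ X := (abs_nonneg _).trans hx
  have hY : 0 ≤ Y := (abs_nonneg _).trans hy
  intro n
  induction n with
  | zero =>
    refine ⟨by simpa [dtseq] using hy', ?_⟩
    have h1 : |x' * y + x * y' - w'| ≤ |x'| * |y| + |x| * |y'| + |w'| := by
      rw [← abs_mul, ← abs_mul]
      exact (abs_sub _ _).trans (by gcongr; exact abs_add_le _ _)
    have h2 : |x| * |y'| ≤ X * Y := mul_le_mul hx hy' (abs_nonneg _) hX
    have h3 : |x'| * |y| ≤ 1 * Y := mul_le_mul hx' hy (abs_nonneg _) zero_le_one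
    simp only [dtseq, zero_add, pow_one]
    nlinarith
  | succ n ih =>
    refine ⟨ih.2, ?_⟩
    have ht := (tseq_bound hx hy hw n).2
    have h1 : |dtseq x y w x' y' w' (n + 1 + 1)| ≤ |x'| * |tseq x y w (n + 1)|
        + |x| * |dtseq x y w x' y' w' (n + 1)| + |dtseq x y w x' y' w' n| := by
      simp only [dtseq]; rw [← abs_mul, ← abs_mul]
      exact (abs_sub _ _).trans (by gcongr; exact abs_add_le _ _)
    have h2 : |x| * |dtseq x y w x' y' w' (n + 1)| ≤ X * (Y * (X + 2) ^ (n + 1)) :=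
      mul_le_mul hx ih.2 (abs_nonneg _) hX
    have h2' : |x'| * |tseq x y w (n + 1)| ≤ 1 * (Y * (X + 2) ^ (n + 1)) :=
      mul_le_mul hx' ht (abs_nonneg _) zero_le_one
    have h3 : 0 ≤ Y * (X + 2) ^ n := by positivity
    have h4 : 0 ≤ X * (Y * (X + 2) ^ n) := by positivity
    have h5 := ih.1
    calc _ ≤ _ := h1
      _ ≤ 1 * (Y * (X + 2) ^ (n + 1)) + X * (Y * (X + 2) ^ (n + 1)) + Y * (X + 2) ^ n := by linarith
      _ ≤ _ := by
        rw [pow_succ (X + 2) (n + 1), pow_succ (X + 2) n]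
        nlinarith

/-- Wronskian lower bound. -/
lemma wronskian_lower (x y w y' w' : ℝ) :
    ∀ n, y ^ 2 - w' * y + w * y' ≤
      dtseq x y w 1 y' w' (n + 1) * tseq x y w n - tseq x y w (n + 1) * dtseq x y w 1 y' w' n := by
  intro n
  induction n with
  | zero => simp only [tseq, dtseq]; nlinarith
  | succ n ih =>
    simp only [tseq, dtseq] at ih ⊢
    nlinarith [sq_nonneg (tseq x y w (n + 1))]

lemma tseq_expand (x y w : ℝ) : ∀ n,
    tseq x y w (n + 1) = tseq x 1 0 (n + 1) * y - tseq x 1 0 n * w ∧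
    tseq x y w (n + 2) = tseq x 1 0 (n + 2) * y - tseq x 1 0 (n + 1) * w := by
  intro n
  induction n with
  | zero => simp only [tseq]; constructor <;> ring
  | succ n ih =>
    refine ⟨ih.2, ?_⟩
    have e1 : ∀ a b c : ℝ, tseq a b c (n + 1 + 2) = a * tseq a b c (n + 2) - tseq a b c (n + 1) :=
      fun a b c => rfl
    have e2 : ∀ a b c : ℝ, tseq a b c (n + 2) = a * tseq a b c (n + 1) - tseq a b c n :=
      fun a b c => rfl
    rw [e1 x y w, e1 x 1 0, ih.1, ih.2]
    rw [e2 x 1 0]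
    ring

lemma dtseq_expand (x y w x' y' w' : ℝ) : ∀ n,
    (dtseq x y w x' y' w' (n + 1) = dtseq x 1 0 1 0 0 (n + 1) * x' * y + tseq x 1 0 (n + 1) * y'
      - dtseq x 1 0 1 0 0 n * x' * w - tseq x 1 0 n * w') ∧
    (dtseq x y w x' y' w' (n + 2) = dtseq x 1 0 1 0 0 (n + 2) * x' * y + tseq x 1 0 (n + 2) * y'
      - dtseq x 1 0 1 0 0 (n + 1) * x' * w - tseq x 1 0 (n + 1) * w') := by
  intro n
  induction n with
  | zero => simp only [tseq, dtseq]; constructor <;> ring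
  | succ n ih =>
    refine ⟨ih.2, ?_⟩
    have d1 : ∀ b c a' b' c' : ℝ, dtseq x b c a' b' c' (n + 1 + 2) =
      a' * tseq x b c (n + 2) + x * dtseq x b c a' b' c' (n + 2) - dtseq x b c a' b' c' (n + 1) :=
      fun _ _ _ _ _ => rfl
    have e1 : tseq x 1 0 (n + 1 + 2) = x * tseq x 1 0 (n + 2) - tseq x 1 0 (n + 1) := rfl
    have e2 : tseq x 1 0 (n + 2) = x * tseq x 1 0 (n + 1) - tseq x 1 0 n := rfl
    have d2 : dtseq x 1 0 1 0 0 (n + 2) =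
      1 * tseq x 1 0 (n + 1) + x * dtseq x 1 0 1 0 0 (n + 1) - dtseq x 1 0 1 0 0 n := rfl
    rw [d1 y w, d1 1 0, e1, ih.1, ih.2, (tseq_expand x y w n).2]
    rw [show n + 1 + 1 = n + 2 by ring, d2, e2]
    ring

section core
variable {x y w x' y' w' R W B : ℝ}

lemma core_upper (hB : 1 ≤ B) (hW : 2 ≤ W) (hR : 4 * B * (2 + 2 * B * W + B) ≤ R)
    (hy : R ≤ |y|) (hw : |w| ≤ W) (hy' : |y'| ≤ |y| * |x'|) (hw' : |w'| ≤ |x'|)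
    (n : ℕ) (hU : ∀ i ≤ n, |tseq x 1 0 i| ≤ B ∧ |dtseq x 1 0 1 0 0 i| ≤ B) :
    |dtseq x y w x' y' w' n| ≤ 4 * B * (|y| * |x'|) := by
  have hRW : W ≤ R := by nlinarith [mul_nonneg (sub_nonneg.2 hB) (sub_nonneg.2 hW), mul_nonneg (sub_nonneg.2 hB) (sub_nonneg.2 hB)]
  have hyW : W ≤ |y| := hRW.trans hy
  have hx0 := abs_nonneg x'
  have hyx : 0 ≤ |y| * |x'| := by positivity
  have a3 : |w| * |x'| ≤ |y| * |x'| := mul_le_mul_of_nonneg_right (hw.trans hyW) hx0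
  have a4 : |w'| ≤ |y| * |x'| := by nlinarith
  cases n with
  | zero => simp only [dtseq]; nlinarith
  | succ n =>
    rw [(dtseq_expand x y w x' y' w' n).1]
    obtain ⟨h1, h2⟩ := hU (n + 1) le_rfl
    obtain ⟨h3, h4⟩ := hU n (Nat.le_succ n)
    have b1 : |dtseq x 1 0 1 0 0 (n + 1) * x' * y| ≤ B * (|y| * |x'|) := by
      rw [abs_mul, abs_mul, mul_assoc, mul_comm |x'|]; gcongr
    have b2 : |tseq x 1 0 (n + 1) * y'| ≤ B * (|y| * |x'|) := by
      rw [abs_mul]; gcongr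
    have b3 : |dtseq x 1 0 1 0 0 n * x' * w| ≤ B * (|y| * |x'|) := by
      rw [abs_mul, abs_mul, mul_assoc, mul_comm |x'|]; gcongr
    have b4 : |tseq x 1 0 n * w'| ≤ B * (|y| * |x'|) := by
      rw [abs_mul]; gcongr
    rw [abs_le] at *
    constructor <;> linarith [b1.1, b1.2, b2.1, b2.2, b3.1, b3.2, b4.1, b4.2]

lemma core_lower (hB : 1 ≤ B) (hW : 2 ≤ W) (hR : 4 * B * (2 + 2 * B * W + B) ≤ R)
    (hy : R ≤ |y|) (hw : |w| ≤ W) (hy' : |y'| ≤ |y| * |x'|) (hw' : |w'| ≤ |x'|)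
    (n : ℕ) (hU : ∀ i ≤ n + 1, |tseq x 1 0 i| ≤ B ∧ |dtseq x 1 0 1 0 0 i| ≤ B)
    (ht : |tseq x y w (n + 1)| ≤ 2) :
    |y| * |x'| ≤ 4 * B * |dtseq x y w x' y' w' (n + 1)| := by
  have hB0 : 0 < B := by linarith
  have hx0 := abs_nonneg x'
  obtain ⟨h1, h2⟩ := hU (n + 1) le_rfl
  obtain ⟨h3, h4⟩ := hU n (Nat.le_succ n)
  have hy0 : 0 < |y| := lt_of_lt_of_le (by positivity) (hR.trans hy)
  have hRy : 4 * B * (2 + 2 * B * W + B) ≤ |y| := hR.trans hy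
  -- U small
  have hUy : |tseq x 1 0 (n + 1)| * |y| ≤ 2 + B * W := by
    have e := (tseq_expand x y w n).1
    have e' : tseq x 1 0 (n + 1) * y = tseq x y w (n + 1) + tseq x 1 0 n * w := by linarith
    rw [← abs_mul, e']
    refine (abs_add_le _ _).trans ?_
    rw [abs_mul]
    gcongr
  have hUs : |tseq x 1 0 (n + 1)| * B ≤ 1 / 4 := by
    have : |tseq x 1 0 (n + 1)| * (4 * B * (2 + 2 * B * W + B)) ≤ 2 + B * W :=
      (mul_le_mul_of_nonneg_left hRy (abs_nonneg _)).trans hUy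
    by_contra hcon
    push Not at hcon
    have : 1 * (2 + 2 * B * W + B) ≤ (|tseq x 1 0 (n + 1)| * B * 4) * (2 + 2 * B * W + B) := by
      gcongr; linarith
    nlinarith [mul_pos hB0 (by linarith : 0 < W)]
  have hdU : 1 / 2 ≤ |dtseq x 1 0 1 0 0 (n + 1)| * B := by
    have hw1 := wronskian_lower x 1 0 0 0 n
    have c1 : dtseq x 1 0 1 0 0 (n + 1) * tseq x 1 0 n ≤ |dtseq x 1 0 1 0 0 (n + 1)| * B := by
      refine (le_abs_self _).trans ?_
      rw [abs_mul]; gcongr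
    have c2 : - (tseq x 1 0 (n + 1) * dtseq x 1 0 1 0 0 n) ≤ |tseq x 1 0 (n + 1)| * B := by
      refine (neg_le_abs _).trans ?_
      rw [abs_mul]; gcongr
    linarith
  set D := |dtseq x y w x' y' w' (n + 1)| with hD
  have key : |dtseq x 1 0 1 0 0 (n + 1)| * (|x'| * |y|) ≤
      D + |tseq x 1 0 (n + 1)| * (|y| * |x'|) + B * (|x'| * W) + B * |x'| := by
    have e : dtseq x 1 0 1 0 0 (n + 1) * x' * y = dtseq x y w x' y' w' (n + 1)
      - tseq x 1 0 (n + 1) * y' + dtseq x 1 0 1 0 0 n * x' * w + tseq x 1 0 n * w' := by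
      rw [(dtseq_expand x y w x' y' w' n).1]; ring
    rw [← abs_mul, ← abs_mul, ← mul_assoc, e]
    refine (abs_add_le _ _).trans ?_
    refine add_le_add ((abs_add_le _ _).trans ?_) ?_
    · refine add_le_add ((abs_sub _ _).trans ?_) ?_
      · rw [abs_mul (tseq x 1 0 (n+1))]; gcongr
      · rw [mul_assoc, abs_mul, abs_mul]; gcongr
    · rw [abs_mul]; gcongr
  -- multiply by B
  have k2 : 1 / 2 * (|x'| * |y|) ≤ B * D + B * (2 + B * W) * |x'| + B * B * W * |x'| + B * B * |x'| := by
    have s1 : 1 / 2 * (|x'| * |y|) ≤ |dtseq x 1 0 1 0 0 (n + 1)| * B * (|x'| * |y|) := by gcongr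
    have s2 : B * |x'| * (|tseq x 1 0 (n + 1)| * |y|) ≤ B * |x'| * (2 + B * W) := by gcongr
    nlinarith
  have k3 : 4 * B * (2 + 2 * B * W + B) * |x'| ≤ |y| * |x'| := by gcongr
  nlinarith

end core

/-! ### Part 2: orbits of the trace map along a Stern-Brocot path -/

/-- Orbit of the triple `(x,y,w)` of traces (of `A`, `B`, `A B⁻¹`) together with derivatives,
along a direction sequence `d`. -/
structure TrOrbit (d : ℕ → Bool) (x y w x' y' w' : ℕ → ℝ) : Prop where
  left : ∀ k, d k = true → x (k + 1) = x k ∧ y (k + 1) = x k * y k - w k ∧ w (k + 1) = y k ∧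
    x' (k + 1) = x' k ∧ y' (k + 1) = x' k * y k + x k * y' k - w' k ∧ w' (k + 1) = y' k
  right : ∀ k, d k = false → x (k + 1) = x k * y k - w k ∧ y (k + 1) = y k ∧ w (k + 1) = x k ∧
    x' (k + 1) = x' k * y k + x k * y' k - w' k ∧ y' (k + 1) = y' k ∧ w' (k + 1) = x' k

/-- The escape condition. -/
def Esc (x y w : ℝ) : Prop := 2 < |x| ∧ 2 < |y| ∧ (|w| ≤ |x| ∨ |w| ≤ |y|)

/-- States with one small trace `s`. -/
def GoodState (W s l w s' l' w' : ℝ) : Prop :=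
  |s| ≤ 2 ∧ |w| ≤ W ∧ |l'| ≤ |l| * |s'| ∧ |w'| ≤ |s'|

lemma Esc.symm {x y w : ℝ} (h : Esc x y w) : Esc y x w := ⟨h.2.1, h.1, h.2.2.symm⟩

lemma Esc.next {x y w : ℝ} (h : Esc x y w) : |x| < |x * y - w| ∧ |y| < |x * y - w| := by
  obtain ⟨h1, h2, h3⟩ := h
  have h4 : |x| * |y| - |w| ≤ |x * y - w| := by
    rw [← abs_mul]; exact abs_sub_abs_le_abs_sub _ _
  rcases h3 with h3 | h3
  · constructor <;> nlinarith
  · constructor <;> nlinarith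

lemma Esc.left {x y w : ℝ} (h : Esc x y w) : Esc x (x * y - w) y :=
  ⟨h.1, h.1.trans h.next.1, Or.inr h.next.2.le⟩

lemma Esc.right {x y w : ℝ} (h : Esc x y w) : Esc (x * y - w) y x :=
  ⟨h.1.trans h.next.1, h.2.1, Or.inl h.next.1.le⟩

namespace TrOrbit
variable {d : ℕ → Bool} {x y w x' y' w' : ℕ → ℝ}

lemma swap (h : TrOrbit d x y w x' y' w') : TrOrbit (fun k => !d k) y x w y' x' w' where
  left k hk := by
    obtain ⟨h1, h2, h3, h4, h5, h6⟩ := h.right k (by simpa using hk)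
    exact ⟨h2, by rw [h1]; ring, h3, h5, by rw [h4]; ring, h6⟩
  right k hk := by
    obtain ⟨h1, h2, h3, h4, h5, h6⟩ := h.left k (by simpa using hk)
    exact ⟨by rw [h2]; ring, h1, h3, by rw [h5]; ring, h4, h6⟩

lemma esc_succ (h : TrOrbit d x y w x' y' w') {k : ℕ} (he : Esc (x k) (y k) (w k)) :
    Esc (x (k + 1)) (y (k + 1)) (w (k + 1)) := by
  cases hd : d k with
  | true =>
    obtain ⟨h1, h2, h3, -⟩ := h.left k hd
    rw [h1, h2, h3]; exact he.left
  | false =>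
    obtain ⟨h1, h2, h3, -⟩ := h.right k hd
    rw [h1, h2, h3]; exact he.right

lemma esc_of_le (h : TrOrbit d x y w x' y' w') {k N : ℕ} (hk : k ≤ N)
    (he : Esc (x k) (y k) (w k)) : Esc (x N) (y N) (w N) := by
  induction N, hk using Nat.le_induction with
  | base => exact he
  | succ n _ ih => exact h.esc_succ ih

lemma inv (h : TrOrbit d x y w x' y' w') {k N : ℕ} (hk : k ≤ N) :
    x N ^ 2 + y N ^ 2 + w N ^ 2 - x N * y N * w N =
    x k ^ 2 + y k ^ 2 + w k ^ 2 - x k * y k * w k := by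
  induction N, hk using Nat.le_induction with
  | base => rfl
  | succ n _ ih =>
    rw [← ih]
    cases hd : d n with
    | true =>
      obtain ⟨h1, h2, h3, -⟩ := h.left n hd
      rw [h1, h2, h3]; ring
    | false =>
      obtain ⟨h1, h2, h3, -⟩ := h.right n hd
      rw [h1, h2, h3]; ring

lemma run (h : TrOrbit d x y w x' y' w') (k : ℕ) : ∀ j, (∀ i < j, d (k + i) = true) →
    x (k + j) = x k ∧ x' (k + j) = x' k ∧ y (k + j) = tseq (x k) (y k) (w k) j ∧
    y' (k + j) = dtseq (x k) (y k) (w k) (x' k) (y' k) (w' k) j ∧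
    x (k + j) * y (k + j) - w (k + j) = tseq (x k) (y k) (w k) (j + 1) ∧
    x' (k + j) * y (k + j) + x (k + j) * y' (k + j) - w' (k + j) =
      dtseq (x k) (y k) (w k) (x' k) (y' k) (w' k) (j + 1) := by
  intro j
  induction j with
  | zero => intro _; simp [tseq, dtseq]
  | succ j ih =>
    intro hd
    obtain ⟨a1, a2, a3, a4, a5, a6⟩ := ih (fun i hi => hd i (by omega))
    obtain ⟨h1, h2, h3, h4, h5, h6⟩ := h.left (k + j) (hd j (by omega))
    rw [← add_assoc, h1, h2, h3, h4, h5, h6, a5, a6, a1, a2, a3, a4]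
    refine ⟨rfl, rfl, rfl, rfl, rfl, rfl⟩

lemma run_end (h : TrOrbit d x y w x' y' w') (k j : ℕ) (hd : ∀ i < j, d (k + i) = true)
    (hj : d (k + j) = false) :
    x (k + j + 1) = tseq (x k) (y k) (w k) (j + 1) ∧ y (k + j + 1) = tseq (x k) (y k) (w k) j ∧
    w (k + j + 1) = x k ∧
    x' (k + j + 1) = dtseq (x k) (y k) (w k) (x' k) (y' k) (w' k) (j + 1) ∧
    y' (k + j + 1) = dtseq (x k) (y k) (w k) (x' k) (y' k) (w' k) j ∧
    w' (k + j + 1) = x' k := by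
  obtain ⟨a1, a2, a3, a4, a5, a6⟩ := h.run k j hd
  obtain ⟨h1, h2, h3, h4, h5, h6⟩ := h.right (k + j) hj
  exact ⟨h1.trans a5, h2.trans a3, h3.trans a1, h4.trans a6, h5.trans a4, h6.trans a2⟩

end TrOrbit

lemma first_false {d : ℕ → Bool} {K k : ℕ} (h : ∃ j ≤ K, d (k + j) = false) :
    ∃ j ≤ K, (∀ i < j, d (k + i) = true) ∧ d (k + j) = false := by
  classical
  obtain ⟨j0, hj0, hf⟩ := h
  have hex : ∃ j, d (k + j) = false := ⟨j0, hf⟩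
  refine ⟨Nat.find hex, (Nat.find_min' hex hf).trans hj0, fun i hi => ?_, Nat.find_spec hex⟩
  simpa using Nat.find_min hex hi

lemma large_of_inv {s l w R W : ℝ} (hs : |s| ≤ 2) (hw : |w| ≤ W)
    (hI : R ^ 2 + 2 * W * R + 4 + W ^ 2 ≤ s ^ 2 + l ^ 2 + w ^ 2 - s * l * w) (hR : 0 ≤ R) :
    R ≤ |l| := by
  by_contra hc
  push Not at hc
  have hW : 0 ≤ W := (abs_nonneg _).trans hw
  have h1 : s ^ 2 ≤ 4 := by rw [← sq_abs]; nlinarith [abs_nonneg s]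
  have h2 : w ^ 2 ≤ W ^ 2 := by rw [← sq_abs w]; gcongr
  have h3 : l ^ 2 < R ^ 2 := by rw [← sq_abs l]; gcongr
  have h4 : -(s * l * w) ≤ 2 * R * W := by
    refine (neg_le_abs _).trans ?_
    rw [abs_mul, abs_mul]; gcongr
  nlinarith

/-- The bigrun step. -/
lemma bigrun_step {d : ℕ → Bool} {x y w x' y' w' : ℕ → ℝ} (h : TrOrbit d x y w x' y' w')
    {K k : ℕ} {R W B : ℝ} (hK : ∃ j ≤ K, d (k + j) = false)
    (hB : 1 ≤ B) (hBK : (4 : ℝ) ^ (K + 1) ≤ B) (hW : 2 ≤ W)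
    (hR : 4 * B * (2 + 2 * B * W + B) ≤ R)
    (hI : R ^ 2 + 2 * W * R + 4 + W ^ 2 ≤ x k ^ 2 + y k ^ 2 + w k ^ 2 - x k * y k * w k)
    (hg : GoodState W (x k) (y k) (w k) (x' k) (y' k) (w' k))
    (hne : ∀ i ≤ K, ¬ Esc (x (k + i + 1)) (y (k + i + 1)) (w (k + i + 1))) :
    ∃ k', k < k' ∧ k' ≤ k + K + 1 ∧
      ((GoodState W (x k') (y k') (w k') (x' k') (y' k') (w' k') ∧ R / (4 * B) * |x' k| ≤ |x' k'|) ∨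
       (GoodState W (y k') (x k') (w k') (y' k') (x' k') (w' k') ∧ R / (4 * B) * |x' k| ≤ |y' k'|)) := by
  obtain ⟨j, hj, hd, hf⟩ := first_false hK
  have hB0 : 0 < B := by linarith
  have hR0 : 16 * B ^ 2 ≤ R := by nlinarith [mul_nonneg (sq_nonneg B) (sub_nonneg.2 hW)]
  have hRp : 0 ≤ R := by nlinarith
  have hR2 : 2 < R := by nlinarith
  obtain ⟨g1, g2, g3, g4⟩ := hg
  obtain ⟨e1, e2, e3, e4, e5, e6⟩ := h.run_end k j hd hf
  have hyR : R ≤ |y k| := large_of_inv g1 g2 hI hRp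
  have hU : ∀ i ≤ j + 1, |tseq (x k) 1 0 i| ≤ B ∧ |dtseq (x k) 1 0 1 0 0 i| ≤ B := by
    intro i hi
    have hp : (1 : ℝ) * (2 + 2) ^ i ≤ B := by
      refine le_trans ?_ hBK
      rw [one_mul]; norm_num
      gcongr
      · norm_num
      · omega
    exact ⟨(tseq_bound g1 (by simp) (by simp) i).1.trans hp,
      (dtseq_bound g1 (by simp) (by simp) (by simp) (by simp) (by simp) i).1.trans hp⟩
  have hinv := h.inv (show k ≤ k + j + 1 by omega)
  have hx0 := abs_nonneg (x' k)
  -- consequences once a small trace has been found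
  have main : ∀ a b : ℕ, a + 1 ≤ j + 1 → b ≤ j + 1 → |tseq (x k) (y k) (w k) (a + 1)| ≤ 2 →
      R ≤ |tseq (x k) (y k) (w k) b| →
      GoodState W (tseq (x k) (y k) (w k) (a + 1)) (tseq (x k) (y k) (w k) b) (x k)
        (dtseq (x k) (y k) (w k) (x' k) (y' k) (w' k) (a + 1))
        (dtseq (x k) (y k) (w k) (x' k) (y' k) (w' k) b) (x' k) ∧
      R / (4 * B) * |x' k| ≤ |dtseq (x k) (y k) (w k) (x' k) (y' k) (w' k) (a + 1)| := by
    intro a b ha hb hsm hlg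
    have lo := core_lower hB hW hR hyR g2 g3 g4 a (fun i hi => hU i (by omega)) hsm
    have up := core_upper hB hW hR hyR g2 g3 g4 b (fun i hi => hU i (by omega))
    set D := |dtseq (x k) (y k) (w k) (x' k) (y' k) (w' k) (a + 1)| with hD
    have hD0 : 0 ≤ D := abs_nonneg _
    have c1 : R * |x' k| ≤ 4 * B * D := le_trans (by gcongr) lo
    refine ⟨⟨hsm, g1.trans hW, ?_, ?_⟩, ?_⟩
    · rw [← hD]
      calc _ ≤ _ := up
        _ ≤ 4 * B * (4 * B * D) := by gcongr
        _ = 16 * B ^ 2 * D := by ring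
        _ ≤ _ := by gcongr; exact hR0.trans hlg
    · rw [← hD]
      have : 4 * B * |x' k| ≤ R * |x' k| := by gcongr; nlinarith
      have : 4 * B * |x' k| ≤ 4 * B * D := by linarith
      exact le_of_mul_le_mul_left this (by positivity)
    · rw [div_mul_eq_mul_div, div_le_iff₀ (by positivity)]
      linarith
  refine ⟨k + j + 1, by omega, by omega, ?_⟩
  have hn := hne j hj
  rw [← hinv, e1, e2, e3] at hI
  rw [e1, e2, e3] at hn
  rw [e1, e2, e3, e4, e5, e6]
  by_cases hs : |tseq (x k) (y k) (w k) (j + 1)| ≤ 2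
  · left
    exact main j j le_rfl (by omega) hs (large_of_inv hs (g1.trans hW) hI hRp)
  · right
    have hs2 : |tseq (x k) (y k) (w k) j| ≤ 2 := by
      by_contra hc
      push Not at hs hc
      exact hn ⟨hs, hc, Or.inl (g1.trans hs.le)⟩
    have hlarge : R ≤ |tseq (x k) (y k) (w k) (j + 1)| :=
      large_of_inv hs2 (g1.trans hW) (by linarith) hRp
    cases j with
    | zero =>
      simp only [tseq] at hs2
      linarith
    | succ a => exact main a (a + 1 + 1) (by omega) le_rfl hs2 hlarge

/-- Iterating the bigrun step. -/
lemma bigrun_iter {d : ℕ → Bool} {x y w x' y' w' : ℕ → ℝ} (h : TrOrbit d x y w x' y' w')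
    {K k₀ N : ℕ} {R W B : ℝ} (hK0 : ∀ k, ∃ j ≤ K, d (k + j) = false)
    (hK1 : ∀ k, ∃ j ≤ K, d (k + j) = true)
    (hB : 1 ≤ B) (hBK : (4 : ℝ) ^ (K + 1) ≤ B) (hW : 2 ≤ W)
    (hR : 4 * B * (2 + 2 * B * W + B) ≤ R)
    (hI : R ^ 2 + 2 * W * R + 4 + W ^ 2 ≤ x k₀ ^ 2 + y k₀ ^ 2 + w k₀ ^ 2 - x k₀ * y k₀ * w k₀)
    (hg : (GoodState W (x k₀) (y k₀) (w k₀) (x' k₀) (y' k₀) (w' k₀) ∧ 1 ≤ |x' k₀|) ∨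
      (GoodState W (y k₀) (x k₀) (w k₀) (y' k₀) (x' k₀) (w' k₀) ∧ 1 ≤ |y' k₀|))
    (hne : ∀ i ≤ N, ¬ Esc (x i) (y i) (w i)) :
    ∀ n, k₀ + n * (K + 1) ≤ N → ∃ k, k₀ ≤ k ∧ k ≤ k₀ + n * (K + 1) ∧
      ((GoodState W (x k) (y k) (w k) (x' k) (y' k) (w' k) ∧ (R / (4 * B)) ^ n ≤ |x' k|) ∨
       (GoodState W (y k) (x k) (w k) (y' k) (x' k) (w' k) ∧ (R / (4 * B)) ^ n ≤ |y' k|)) := by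
  intro n
  induction n with
  | zero => intro _; exact ⟨k₀, le_rfl, by omega, by simpa using hg⟩
  | succ n ih =>
    intro hN
    have hN' : k₀ + n * (K + 1) + K + 1 ≤ N := by rw [add_mul] at hN; omega
    obtain ⟨k, hk0, hk, hc⟩ := ih (by omega)
    have hinv := h.inv hk0
    have hΛ : 0 ≤ R / (4 * B) := by
      have : 0 ≤ R := le_trans (by positivity) hR
      positivity
    rcases hc with ⟨g, hd⟩ | ⟨g, hd⟩
    · obtain ⟨k', h1, h2, h3⟩ := bigrun_step h (hK0 k) hB hBK hW hR (by rw [hinv]; exact hI) g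
        (fun i hi => hne _ (by omega))
      refine ⟨k', by omega, by rw [add_mul]; omega, ?_⟩
      have hp : (R / (4 * B)) ^ (n + 1) ≤ R / (4 * B) * |x' k| := by
        rw [pow_succ']; gcongr
      exact h3.imp (fun q => ⟨q.1, hp.trans q.2⟩) (fun q => ⟨q.1, hp.trans q.2⟩)
    · obtain ⟨k', h1, h2, h3⟩ := bigrun_step h.swap (by simpa using hK1 k) hB hBK hW hR
        (by have := hinv ▸ hI; linarith) g
        (fun i hi he => hne _ (by omega) he.symm)
      refine ⟨k', by omega, by rw [add_mul]; omega, ?_⟩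
      have hp : (R / (4 * B)) ^ (n + 1) ≤ R / (4 * B) * |y' k| := by
        rw [pow_succ']; gcongr
      exact h3.symm.imp (fun q => ⟨q.1, hp.trans q.2⟩) (fun q => ⟨q.1, hp.trans q.2⟩)

/-! ### Part 3: the initial run -/

lemma base_good {s l s' l' G P R₀ : ℝ} (hG : 1 ≤ G) (hs : |s| ≤ 2) (hl : |l| ≤ G * P)
    (hs' : |s'| ≤ G * P) (hl' : |l'| ≤ G * P) (hw : P ^ 2 ≤ |s'| * |l| + |s| * |l'|)
    (hP1 : 4 * G ^ 3 ≤ P) (hP2 : 2 * G * R₀ ≤ P) :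
    |l'| ≤ |l| * |s'| ∧ 1 ≤ |s'| ∧ R₀ ≤ |l| := by
  have hGG : 1 ≤ G ^ 2 := by nlinarith
  have hG3 : G ≤ G ^ 3 := by nlinarith
  have hP4 : 4 * G ≤ P := by linarith
  have hP0 : 0 < P := by linarith
  have h1 : |s| * |l'| ≤ 2 * (G * P) := by gcongr
  have h2 : 2 * (G * P) ≤ P ^ 2 / 2 := by nlinarith
  have h3 : P ^ 2 / 2 ≤ |s'| * |l| := by linarith
  have h4 : P ^ 2 / 2 ≤ G * P * |l| := h3.trans (by gcongr)
  have h5 : P ^ 2 / 2 ≤ |s'| * (G * P) := h3.trans (by gcongr)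
  have h6 : P ≤ 2 * G * |l| := by
    have : P * P ≤ P * (2 * G * |l|) := by nlinarith
    exact le_of_mul_le_mul_left this hP0
  have h7 : P ≤ 2 * G * |s'| := by
    have : P * P ≤ P * (2 * G * |s'|) := by nlinarith
    exact le_of_mul_le_mul_left this hP0
  refine ⟨?_, ?_, ?_⟩
  · have : G * P ≤ P ^ 2 / 2 := by nlinarith
    linarith [mul_comm |l| |s'|]
  · by_contra hc; push Not at hc; nlinarith
  · have : 2 * G * R₀ ≤ 2 * G * |l| := hP2.trans h6
    exact le_of_mul_le_mul_left this (by positivity)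

lemma base_inv {s l E R W : ℝ} (hs : |s| ≤ 2) (hl : R + 4 * W + 4 ≤ |l|) (hE : |E| ≤ W)
    (hR : 0 ≤ R) (hW : 0 ≤ W) :
    R ^ 2 + 2 * W * R + 4 + W ^ 2 ≤ s ^ 2 + l ^ 2 + E ^ 2 - s * l * E := by
  have h4 : (s * l * E) ≤ 2 * |l| * W := by
    refine (le_abs_self _).trans ?_
    rw [abs_mul, abs_mul]; gcongr
  have h5 : l ^ 2 = |l| ^ 2 := (sq_abs l).symm
  have h6 : (R + 4 * W + 4) * (R + 2 * W + 4) ≤ |l| * (|l| - 2 * W) := by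
    apply mul_le_mul hl (by linarith) (by positivity) (abs_nonneg _)
  have h7 : R ^ 2 + 2 * W * R + 4 + W ^ 2 ≤ (R + 4 * W + 4) * (R + 2 * W + 4) := by
    have := mul_nonneg hR hW
    have := sq_nonneg W
    nlinarith
  have h8 : |l| * (|l| - 2 * W) = |l| ^ 2 - 2 * |l| * W := by ring
  have h9 := sq_nonneg s
  have h10 := sq_nonneg E
  linarith

set_option maxHeartbeats 1000000 in
lemma base_step {d : ℕ → Bool} {x y w x' y' w' : ℕ → ℝ} (h : TrOrbit d x y w x' y' w')
    {K : ℕ} {R W E p q G : ℝ} (hK : ∃ j ≤ K, d (0 + j) = false)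
    (hx : x 0 = E) (hy : y 0 = (E - q) / p) (hw : w 0 = 1 / p + p)
    (hx' : x' 0 = 1) (hy' : y' 0 = 1 / p) (hw' : w' 0 = 0)
    (hp : p ≠ 0) (hp1 : |p| ≤ 1) (hW : 2 ≤ W) (hq : |q| ≤ W) (hE : |E| ≤ W)
    (hR : 0 ≤ R) (hG : G = 2 * W * (W + 2) ^ (K + 1))
    (hP1 : 4 * G ^ 3 ≤ 1 / |p|) (hP2 : 2 * G * (R + 4 * W + 4) ≤ 1 / |p|)
    (hne : ∀ i ≤ K + 1, ¬ Esc (x i) (y i) (w i)) :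
    ∃ k₀ ≤ K + 1, 
      R ^ 2 + 2 * W * R + 4 + W ^ 2 ≤ x k₀ ^ 2 + y k₀ ^ 2 + w k₀ ^ 2 - x k₀ * y k₀ * w k₀ ∧
      ((GoodState W (x k₀) (y k₀) (w k₀) (x' k₀) (y' k₀) (w' k₀) ∧ 1 ≤ |x' k₀|) ∨
      (GoodState W (y k₀) (x k₀) (w k₀) (y' k₀) (x' k₀) (w' k₀) ∧ 1 ≤ |y' k₀|)) := by
  obtain ⟨j, hj, hd, hf⟩ := first_false hK
  have hp0 : 0 < |p| := abs_pos.2 hp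
  set P := 1 / |p| with hPdef
  have hPp : P * |p| = 1 := by rw [hPdef]; field_simp
  have hP : 1 ≤ P := by rw [hPdef, le_div_iff₀ hp0]; linarith
  have hpow : (1 : ℝ) ≤ (W + 2) ^ (K + 1) := one_le_pow₀ (by linarith)
  have hG1 : 1 ≤ G := by rw [hG]; nlinarith
  obtain ⟨e1, e2, e3, e4, e5, e6⟩ := h.run_end 0 j hd hf
  rw [hx, hy, hw, hx', hy', hw'] at e4 e5
  rw [hx, hy, hw] at e1 e2
  rw [hx] at e3
  rw [hx'] at e6
  rw [zero_add] at e1 e2 e3 e4 e5 e6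
  set T := tseq E ((E - q) / p) (1 / p + p) with hT
  set D := dtseq E ((E - q) / p) (1 / p + p) 1 (1 / p) 0 with hDdef
  have by0 : |(E - q) / p| ≤ 2 * W * P := by
    rw [abs_div, hPdef, mul_one_div]
    gcongr
    exact (abs_sub _ _).trans (by linarith)
  have bw0 : |1 / p + p| ≤ 2 * W * P := by
    refine (abs_add_le _ _).trans ?_
    rw [abs_div, abs_one, ← hPdef]
    nlinarith
  have by1 : |1 / p| ≤ 2 * W * P := by
    rw [abs_div, abs_one, ← hPdef]; nlinarith
  have hmono : ∀ i ≤ K + 1, 2 * W * P * (W + 2) ^ i ≤ G * P := by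
    intro i hi
    have : (W + 2) ^ i ≤ (W + 2) ^ (K + 1) := pow_le_pow_right₀ (by linarith) hi
    rw [hG]
    have h0 : 0 ≤ 2 * W * P := by positivity
    nlinarith [mul_le_mul_of_nonneg_left this h0]
  have bT : ∀ i ≤ K + 1, |T i| ≤ G * P := fun i hi =>
    ((tseq_bound hE by0 bw0 i).1).trans (hmono i hi)
  have bD : ∀ i ≤ K + 1, |D i| ≤ G * P := fun i hi =>
    ((dtseq_bound hE by0 bw0 (by simp) by1 (by simpa using by positivity) i).1).trans (hmono i hi)
  have hwr : P ^ 2 ≤ |D (j + 1)| * |T j| + |T (j + 1)| * |D j| := by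
    have h1 := wronskian_lower E ((E - q) / p) (1 / p + p) (1 / p) 0 j
    have h2 : P ^ 2 ≤ (1 / p + p) * (1 / p) := by
      have : P ^ 2 = (1 / p) * (1 / p) := by
        rw [hPdef, div_pow, one_pow, sq_abs]; field_simp
      rw [this, add_mul, mul_one_div_cancel hp]; linarith
    have h3 : D (j + 1) * T j ≤ |D (j + 1)| * |T j| := by rw [← abs_mul]; exact le_abs_self _
    have h4 : -(T (j + 1) * D j) ≤ |T (j + 1)| * |D j| := by rw [← abs_mul]; exact neg_le_abs _
    have h5 := sq_nonneg ((E - q) / p)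
    linarith
  have hinvl : ∀ s l : ℝ, |s| ≤ 2 → R + 4 * W + 4 ≤ |l| →
      R ^ 2 + 2 * W * R + 4 + W ^ 2 ≤ s ^ 2 + l ^ 2 + E ^ 2 - s * l * E :=
    fun s l hs hl => base_inv hs hl hE hR (by linarith)
  refine ⟨j + 1, by omega, ?_⟩
  have hn := hne (j + 1) (by omega)
  rw [e1, e2, e3] at hn
  rw [e1, e2, e3, e4, e5, e6]
  by_cases hs : |T (j + 1)| ≤ 2
  · obtain ⟨a1, a2, a3⟩ := base_good hG1 hs (bT j (by omega)) (bD (j + 1) (by omega))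
      (bD j (by omega)) hwr hP1 hP2
    exact ⟨hinvl _ _ hs a3, Or.inl ⟨⟨hs, hE, a1, by simpa using a2⟩, a2⟩⟩
  by_cases hs2 : |T j| ≤ 2
  · obtain ⟨a1, a2, a3⟩ := base_good hG1 hs2 (bT (j + 1) (by omega)) (bD j (by omega))
      (bD (j + 1) (by omega)) (by linarith [mul_comm |D (j + 1)| |T j|, mul_comm |T (j + 1)| |D j|])
        hP1 hP2
    exact ⟨by have := hinvl _ _ hs2 a3; linarith, Or.inr ⟨⟨hs2, hE, a1, by simpa using a2⟩, a2⟩⟩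
  · exfalso
    push Not at hs hs2
    refine hn ⟨hs, hs2, ?_⟩
    by_contra hc
    push Not at hc
    obtain ⟨c1, c2⟩ := hc
    have f1 : |D (j + 1)| * |T j| ≤ G * P * W :=
      mul_le_mul (bD _ (by omega)) (by linarith) (abs_nonneg _) (by positivity)
    have f2 : |T (j + 1)| * |D j| ≤ W * (G * P) :=
      mul_le_mul (by linarith) (bD _ (by omega)) (abs_nonneg _) (by positivity)
    have f3 : P * P ≤ P * (2 * G * W) := by
      calc P * P = P ^ 2 := by ring
        _ ≤ _ := hwr
        _ ≤ G * P * W + W * (G * P) := add_le_add f1 f2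
        _ = _ := by ring
    have f4 : P ≤ 2 * G * W := le_of_mul_le_mul_left f3 (by linarith)
    have f5 : 2 * G * (W + 1) ≤ 2 * G * (R + 4 * W + 4) :=
      mul_le_mul_of_nonneg_left (by linarith) (by positivity)
    linarith

/-! ### Part 4: polynomial traces, coverings and the dimension bound -/

open MeasureTheory Polynomial in
lemma poly_cover (P : ℝ[X]) (D : ℕ) (hD : P.natDegree ≤ D) (l : ℝ) (hl : 0 < l) :
    ∃ t : Fin (2 * D + 1) → Set ℝ, (∀ i, Metric.ediam (t i) ≤ ENNReal.ofReal (4 / l)) ∧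
      {E : ℝ | |P.eval E| ≤ 2 ∧ l < |P.derivative.eval E|} ⊆ ⋃ i, t i := by
  classical
  set S := {E : ℝ | |P.eval E| ≤ 2 ∧ l < |P.derivative.eval E|} with hS
  set Q : ℝ[X] := P.derivative ^ 2 - C (l ^ 2) with hQ
  have hQe : ∀ E, Q.eval E = (P.derivative.eval E) ^ 2 - l ^ 2 := by intro E; simp [hQ]
  have hQS : ∀ E ∈ S, 0 < Q.eval E := by
    intro E hE
    rw [hQe, ← sq_abs (P.derivative.eval E)]
    have := hE.2
    nlinarith
  by_cases hne : S.Nonempty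
  swap
  · rw [Set.not_nonempty_iff_eq_empty] at hne
    exact ⟨fun _ => ∅, by simp, by rw [hne]; simp⟩
  obtain ⟨E0, hE0⟩ := hne
  have hQ0 : Q ≠ 0 := by
    intro h0
    have := hQS E0 hE0
    rw [h0] at this
    simp at this
  have hQd : Q.natDegree ≤ 2 * D := by
    refine (natDegree_sub_le _ _).trans ?_
    rw [natDegree_C, max_eq_left (Nat.zero_le _)]
    refine natDegree_pow_le.trans ?_
    have := natDegree_derivative_le P
    omega
  let N : ℝ → ℕ := fun E => (Q.roots.toFinset.filter (fun r => r < E)).card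
  have hN : ∀ E, N E < 2 * D + 1 := by
    intro E
    have h1 : N E ≤ Q.roots.toFinset.card := Finset.card_filter_le _ _
    have h2 := Multiset.toFinset_card_le Q.roots
    have h3 := card_roots' Q
    omega
  refine ⟨fun i => {E | E ∈ S ∧ N E = i}, ?_, ?_⟩
  · intro i
    -- ordered pairs
    have key : ∀ a ∈ S, ∀ b ∈ S, N a = N b → a < b → b - a ≤ 4 / l := by
      intro a ha b hb hab hlt
      have hnr : ∀ r, a ≤ r → r < b → Q.eval r ≠ 0 := by
        intro r hr1 hr2 h0
        have hmem : r ∈ Q.roots.toFinset := by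
          rw [Multiset.mem_toFinset, mem_roots hQ0]; exact h0
        have : N a < N b := by
          apply Finset.card_lt_card
          rw [Finset.ssubset_iff_of_subset]
          · exact ⟨r, by simp only [Finset.mem_filter]; exact ⟨hmem, hr2⟩,
              by simp only [Finset.mem_filter, not_and, not_lt]; intro _; exact hr1⟩
          · intro z hz
            simp only [Finset.mem_filter] at hz ⊢
            exact ⟨hz.1, hz.2.trans hlt⟩
        omega
      have hpos : ∀ c ∈ Set.Ioo a b, 0 < Q.eval c := by
        intro c hc
        by_contra hneg
        push Not at hneg
        have hcont : ContinuousOn (fun z => Q.eval z) (Set.Icc a c) := Q.continuous.continuousOn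
        have := intermediate_value_Icc' hc.1.le hcont
        obtain ⟨r, hr, hr0⟩ := this ⟨hneg, (hQS a ha).le⟩
        exact hnr r hr.1 (hr.2.trans_lt hc.2) hr0
      obtain ⟨c, hc, hc'⟩ := exists_deriv_eq_slope (fun z => P.eval z) hlt
        P.continuous.continuousOn P.differentiable.differentiableOn
      rw [Polynomial.deriv] at hc'
      have hq := hpos c hc
      rw [hQe] at hq
      have hlc : l ≤ |P.derivative.eval c| := by
        by_contra hcon
        push Not at hcon
        have : |P.derivative.eval c| ^ 2 < l ^ 2 := by gcongr
        rw [sq_abs] at this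
        linarith
      rw [hc', abs_div, abs_of_pos (sub_pos.2 hlt), le_div_iff₀ (sub_pos.2 hlt)] at hlc
      have h4 : |P.eval b - P.eval a| ≤ 4 := (abs_sub _ _).trans (by linarith [ha.1, hb.1])
      rw [le_div_iff₀ hl]
      linarith
    refine Metric.ediam_le ?_
    intro a ha b hb
    rw [edist_dist]
    apply ENNReal.ofReal_le_ofReal
    rw [Real.dist_eq]
    rcases lt_trichotomy a b with h | h | h
    · rw [abs_sub_comm, abs_of_pos (sub_pos.2 h)]
      exact key a ha.1 b hb.1 (ha.2.trans hb.2.symm) h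
    · subst h; simp; positivity
    · rw [abs_of_pos (sub_pos.2 h)]
      exact key b hb.1 a ha.1 (hb.2.trans ha.2.symm) h
  · intro E hE
    rw [Set.mem_iUnion]
    exact ⟨⟨N E, hN E⟩, hE, rfl⟩

open MeasureTheory in
lemma dimH_le_of_cover (S : Set ℝ) (s : NNReal) (hs : 0 < s) (B L : ℝ) (hL : 1 < L) (hB : 0 < B)
    (hBL : B ≤ L ^ (s : ℝ))
    (hcov : ∀ n : ℕ, ∃ (m : ℕ) (t : Fin m → Set ℝ), (m : ℝ) ≤ 6 * B ^ (n + 1) ∧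
      (∀ i, Metric.ediam (t i) ≤ ENNReal.ofReal (8 / L ^ n)) ∧ S ⊆ ⋃ i, t i) :
    dimH S ≤ s := by
  choose m t hm ht hS using hcov
  apply dimH_le_of_hausdorffMeasure_ne_top
  have hr : Filter.Tendsto (fun n : ℕ => ENNReal.ofReal (8 / L ^ n)) Filter.atTop (nhds 0) := by
    rw [← ENNReal.ofReal_zero]
    apply ENNReal.tendsto_ofReal
    have := (tendsto_pow_atTop_atTop_of_one_lt hL).const_div_atTop 8
    simpa using this
  have h1 := Measure.hausdorffMeasure_le_liminf_sum (s : ℝ) S (fun n : ℕ => ENNReal.ofReal (8 / L ^ n))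
    hr t (Filter.Eventually.of_forall ht) (Filter.Eventually.of_forall hS)
  have h2 : ∀ n, ∑ i, Metric.ediam (t n i) ^ (s : ℝ) ≤ ENNReal.ofReal (6 * B * 8 ^ (s : ℝ)) := by
    intro n
    have hLn : 0 < L ^ n := by positivity
    calc ∑ i, Metric.ediam (t n i) ^ (s : ℝ) ≤ ∑ i : Fin (m n), ENNReal.ofReal (8 / L ^ n) ^ (s : ℝ) := by
          gcongr with i; exact ht n i
      _ = ENNReal.ofReal (m n * (8 / L ^ n) ^ (s : ℝ)) := by
          rw [Finset.sum_const, Finset.card_univ, Fintype.card_fin, nsmul_eq_mul,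
            ENNReal.ofReal_mul (by positivity), ENNReal.ofReal_natCast,
            ENNReal.ofReal_rpow_of_nonneg (by positivity) s.coe_nonneg]
      _ ≤ _ := by
          apply ENNReal.ofReal_le_ofReal
          have e1 : (8 / L ^ n) ^ (s : ℝ) = 8 ^ (s : ℝ) / (L ^ (s : ℝ)) ^ n := by
            rw [Real.div_rpow (by norm_num) hLn.le, ← Real.rpow_natCast, ← Real.rpow_natCast,
              ← Real.rpow_mul (by linarith), ← Real.rpow_mul (by linarith), mul_comm (n : ℝ)]
          have e2 : B ^ n ≤ (L ^ (s : ℝ)) ^ n := by gcongr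
          rw [e1]
          have e3 : 0 < (L ^ (s : ℝ)) ^ n := by positivity
          have e4 : (0:ℝ) < 8 ^ (s : ℝ) := by positivity
          rw [mul_div_assoc', div_le_iff₀ e3]
          calc (m n : ℝ) * 8 ^ (s : ℝ) ≤ 6 * B ^ (n + 1) * 8 ^ (s : ℝ) := by gcongr; exact hm n
            _ = 6 * B * 8 ^ (s : ℝ) * B ^ n := by ring
            _ ≤ _ := by gcongr
  have h3 := Filter.liminf_le_of_frequently_le' (f := Filter.atTop)
    (Filter.Frequently.of_forall h2)
  exact ne_top_of_le_ne_top ENNReal.ofReal_ne_top (h1.trans h3)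

open Polynomial in
/-- Polynomial trace triples along a direction sequence. -/
noncomputable def polySt (p q : ℝ) (d : ℕ → Bool) : ℕ → ℝ[X] × ℝ[X] × ℝ[X]
  | 0 => (X, C (1 / p) * (X - C q), C (1 / p + p))
  | k + 1 =>
    if d k = true then
      ((polySt p q d k).1, (polySt p q d k).1 * (polySt p q d k).2.1 - (polySt p q d k).2.2,
        (polySt p q d k).2.1)
    else
      ((polySt p q d k).1 * (polySt p q d k).2.1 - (polySt p q d k).2.2, (polySt p q d k).2.1,
        (polySt p q d k).1)

open Polynomial in
lemma polySt_orbit (p q : ℝ) (d : ℕ → Bool) (E : ℝ) :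
    TrOrbit d (fun k => (polySt p q d k).1.eval E) (fun k => (polySt p q d k).2.1.eval E)
      (fun k => (polySt p q d k).2.2.eval E) (fun k => (derivative (polySt p q d k).1).eval E)
      (fun k => (derivative (polySt p q d k).2.1).eval E)
      (fun k => (derivative (polySt p q d k).2.2).eval E) where
  left k hk := by simp [polySt, hk, derivative_mul]
  right k hk := by simp [polySt, hk, derivative_mul]

open Polynomial in
lemma polySt_natDegree (p q : ℝ) (d : ℕ → Bool) (k : ℕ) :
    (polySt p q d k).1.natDegree ≤ 2 ^ k ∧ (polySt p q d k).2.1.natDegree ≤ 2 ^ k ∧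
      (polySt p q d k).2.2.natDegree ≤ 2 ^ k := by
  induction k with
  | zero =>
    refine ⟨by simp [polySt], ?_, by simp only [polySt, natDegree_C]; omega⟩
    simp only [polySt]
    refine (natDegree_C_mul_le _ _).trans ?_
    rw [natDegree_X_sub_C]; simp
  | succ k ih =>
    obtain ⟨h1, h2, h3⟩ := ih
    have h4 : ((polySt p q d k).1 * (polySt p q d k).2.1 - (polySt p q d k).2.2).natDegree
        ≤ 2 ^ (k + 1) := by
      refine (natDegree_sub_le _ _).trans (max_le (natDegree_mul_le.trans ?_) ?_)
      · rw [pow_succ]; omega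
      · rw [pow_succ]; omega
    have h5 : 2 ^ k ≤ 2 ^ (k + 1) := by rw [pow_succ]; omega
    by_cases hd : d k = true
    · simp only [polySt, hd, if_true]
      exact ⟨h1.trans h5, h4, h2.trans h5⟩
    · simp only [polySt, hd]
      exact ⟨h4, h2.trans h5, h1.trans h5⟩

/-! ### Part 5: dimension bound from approximation by periodic spectra -/

open Polynomial in
/-- Covering at stage `n`. -/
lemma stage_cover (p q : ℝ) (d : ℕ → Bool) (K n : ℕ) (L : ℝ) (hL : 0 < L) (F : Set ℝ)
    (hF : ∀ E ∈ F, ∃ k ≤ (n + 1) * (K + 1),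
      (|(polySt p q d k).1.eval E| ≤ 2 ∧ L ^ n ≤ |(derivative (polySt p q d k).1).eval E|) ∨
      (|(polySt p q d k).2.1.eval E| ≤ 2 ∧ L ^ n ≤ |(derivative (polySt p q d k).2.1).eval E|)) :
    ∃ (m : ℕ) (t : Fin m → Set ℝ), (m : ℝ) ≤ 6 * ((4 : ℝ) ^ (K + 1)) ^ (n + 1) ∧
      (∀ i, Metric.ediam (t i) ≤ ENNReal.ofReal (8 / L ^ n)) ∧ closure F ⊆ ⋃ i, t i := by
  set M := (n + 1) * (K + 1) with hM
  have hLn : 0 < L ^ n := by positivity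
  let Pk : ℕ → Bool → ℝ[X] := fun k b => if b then (polySt p q d k).1 else (polySt p q d k).2.1
  have hdeg : ∀ (k : Fin (M + 1)) b, (Pk k b).natDegree ≤ 2 ^ M := by
    intro k b
    have h5 : 2 ^ (k : ℕ) ≤ 2 ^ M := Nat.pow_le_pow_right (by norm_num) (by omega)
    obtain ⟨h1, h2, -⟩ := polySt_natDegree p q d k
    cases b
    · exact h2.trans h5
    · exact h1.trans h5
  have hc := fun (k : Fin (M + 1)) b => poly_cover (Pk k b) (2 ^ M) (hdeg k b) (L ^ n / 2) (by positivity)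
  choose t ht htS using hc
  let ι := Fin (M + 1) × Bool × Fin (2 * 2 ^ M + 1)
  let T : ι → Set ℝ := fun i => closure (t i.1 i.2.1 i.2.2)
  let e : Fin (Fintype.card ι) ≃ ι := (Fintype.equivFin ι).symm
  refine ⟨Fintype.card ι, fun i => T (e i), ?_, ?_, ?_⟩
  · have hcard : Fintype.card ι = (M + 1) * (2 * (2 * 2 ^ M + 1)) := by
      simp [ι]
    have h1 : M + 1 ≤ 2 ^ M := Nat.lt_two_pow_self
    have h2 : 1 ≤ 2 ^ M := Nat.one_le_two_pow
    have h3 : Fintype.card ι ≤ 6 * 4 ^ M := by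
      rw [hcard]
      calc (M + 1) * (2 * (2 * 2 ^ M + 1)) ≤ 2 ^ M * (6 * 2 ^ M) := Nat.mul_le_mul h1 (by omega)
        _ = 6 * 4 ^ M := by rw [show 4 = 2 * 2 by norm_num, mul_pow]; ring
    have h4 : ((4 : ℝ) ^ (K + 1)) ^ (n + 1) = 4 ^ M := by rw [← pow_mul, hM, mul_comm]
    rw [h4]
    exact_mod_cast h3
  · intro i
    simp only [T, Metric.ediam_closure]
    refine (ht _ _ _).trans (le_of_eq ?_)
    congr 1
    field_simp
    norm_num
  · have h1 : F ⊆ ⋃ i : ι, t i.1 i.2.1 i.2.2 := by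
      intro E hE
      obtain ⟨k, hk, hc⟩ := hF E hE
      rw [Set.mem_iUnion]
      rcases hc with ⟨a, b⟩ | ⟨a, b⟩
      · have := htS ⟨k, by omega⟩ true (show E ∈ _ from ⟨a, lt_of_lt_of_le (by linarith) b⟩)
        obtain ⟨i, hi⟩ := Set.mem_iUnion.1 this
        exact ⟨(⟨k, by omega⟩, true, i), hi⟩
      · have := htS ⟨k, by omega⟩ false (show E ∈ _ from ⟨a, lt_of_lt_of_le (by linarith) b⟩)
        obtain ⟨i, hi⟩ := Set.mem_iUnion.1 this
        exact ⟨(⟨k, by omega⟩, false, i), hi⟩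
    refine (closure_mono h1).trans ?_
    rw [closure_iUnion_of_finite]
    intro E hE
    obtain ⟨i, hi⟩ := Set.mem_iUnion.1 hE
    exact Set.mem_iUnion.2 ⟨e.symm i, by simpa [T] using hi⟩

open Polynomial in
theorem dim_bound (d : ℕ → Bool) (K : ℕ) (hK0 : ∀ k, ∃ j ≤ K, d (k + j) = false)
    (hK1 : ∀ k, ∃ j ≤ K, d (k + j) = true) (q : ℝ) (s : NNReal) (hs : 0 < s) :
    ∃ δ > 0, ∀ p : ℝ, p ≠ 0 → |p| < δ → |p| ≤ 1 ∧ ∀ S : Set ℝ,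
      (∀ E ∈ S, ∀ ε > 0, ∀ N₀ : ℕ, ∃ N ≥ N₀, ∃ E' : ℝ, |E' - E| < ε ∧ |E'| ≤ 2 + |q| ∧
        ((polySt p q d N).1 * (polySt p q d N).2.1 - (polySt p q d N).2.2).eval E' = 2) →
      dimH S ≤ s := by
  set B : ℝ := 4 ^ (K + 1) with hBdef
  have hB : 1 ≤ B := one_le_pow₀ (by norm_num)
  set W : ℝ := 2 + |q| with hWdef
  have hW : 2 ≤ W := by rw [hWdef]; linarith [abs_nonneg q]
  have hqW : |q| ≤ W := by rw [hWdef]; linarith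
  set L : ℝ := max (B ^ (1 / (s : ℝ))) (2 + 2 * B * W + B) with hLdef
  have hL2 : 2 + 2 * B * W + B ≤ L := le_max_right _ _
  have hL1 : 1 < L := by nlinarith
  have hL0 : 0 < L := by linarith
  have hsr : (0 : ℝ) < s := by exact_mod_cast hs
  have hBL : B ≤ L ^ (s : ℝ) := by
    calc B = (B ^ (1 / (s : ℝ))) ^ (s : ℝ) := by
          rw [← Real.rpow_mul (by linarith), one_div_mul_cancel hsr.ne', Real.rpow_one]
      _ ≤ L ^ (s : ℝ) := by
          apply Real.rpow_le_rpow (by positivity) (le_max_left _ _) hsr.le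
  set R : ℝ := 4 * B * L with hRdef
  have hR : 4 * B * (2 + 2 * B * W + B) ≤ R := by rw [hRdef]; gcongr
  have hRL : R / (4 * B) = L := by rw [hRdef]; field_simp
  have hR0 : 0 ≤ R := by positivity
  set G : ℝ := 2 * W * (W + 2) ^ (K + 1) with hG
  have hG0 : 0 < G := by positivity
  set Z : ℝ := 4 * G ^ 3 + 2 * G * (R + 4 * W + 4) + 1 with hZ
  have hZ0 : 1 ≤ Z := by
    have : 0 ≤ 4 * G ^ 3 + 2 * G * (R + 4 * W + 4) := by positivity
    linarith
  refine ⟨1 / Z, by positivity, ?_⟩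
  intro p hp hpd
  have hp0 : 0 < |p| := abs_pos.2 hp
  have hZp : Z ≤ 1 / |p| := by
    rw [lt_div_iff₀ (by linarith)] at hpd
    rw [le_div_iff₀ hp0]; linarith
  have hp1 : |p| ≤ 1 := hpd.le.trans (by rw [div_le_one (by linarith)]; exact hZ0)
  have g1 : 0 ≤ 4 * G ^ 3 := by positivity
  have g2 : 0 ≤ 2 * G * (R + 4 * W + 4) := by positivity
  refine ⟨hp1, fun S hS => ?_⟩
  refine dimH_le_of_cover S s hs B L hL1 (by linarith) hBL ?_
  intro n
  set F : Set ℝ := {E' | |E'| ≤ W ∧ ∃ N ≥ (n + 1) * (K + 1),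
    ((polySt p q d N).1 * (polySt p q d N).2.1 - (polySt p q d N).2.2).eval E' = 2} with hFdef
  have hSF : S ⊆ closure F := by
    intro E hE
    rw [Metric.mem_closure_iff]
    intro ε hε
    obtain ⟨N, hN, E', h1, h2, h3⟩ := hS E hE ε hε ((n + 1) * (K + 1))
    refine ⟨E', ⟨h2, N, hN, h3⟩, ?_⟩
    rw [dist_comm, Real.dist_eq]; exact h1
  obtain ⟨m, t, h1, h2, h3⟩ := stage_cover p q d K n L hL0 F (by
    rintro E ⟨hE, N, hN, hz⟩
    have horb := polySt_orbit p q d E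
    have hne : ∀ i ≤ N, ¬ Esc ((polySt p q d i).1.eval E) ((polySt p q d i).2.1.eval E)
        ((polySt p q d i).2.2.eval E) := by
      intro i hi he
      have he' := horb.esc_of_le hi he
      have h4 := he'.next.1
      have h5 := he'.1
      rw [eval_sub, eval_mul] at hz
      rw [hz] at h4
      norm_num at h4
      linarith
    have hKN : K + 1 ≤ N := by
      have : (n + 1) * (K + 1) = n * (K + 1) + (K + 1) := by ring
      omega
    obtain ⟨k₀, hk₀, hI, hgood⟩ := base_step horb (K := K) (R := R) (W := W) (E := E) (p := p)
      (q := q) (G := G) (hK0 0) (by simp [polySt]) (by simp [polySt]; ring) (by simp [polySt])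
      (by simp [polySt]) (by simp [polySt]) (by simp [polySt]) hp hp1 hW hqW hE hR0 hG
      (by linarith) (by linarith) (fun i hi => hne i (by omega))
    have hkk : k₀ + n * (K + 1) ≤ (n + 1) * (K + 1) := by
      have : (n + 1) * (K + 1) = n * (K + 1) + (K + 1) := by ring
      omega
    obtain ⟨k, hk1, hk2, hk3⟩ := bigrun_iter horb (K := K) (N := N) hK0 hK1 hB le_rfl hW hR hI hgood hne n
      (by omega)
    rw [hRL] at hk3
    exact ⟨k, by omega, hk3.imp (fun h => ⟨h.1.1, h.2⟩) (fun h => ⟨h.1.1, h.2⟩)⟩)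
  exact ⟨m, t, h1, h2, hSF.trans h3⟩

/-! ### Arithmetic of the rotation number -/

theorem letter_iff {v : ℤ → Bool} {α β : ℝ} (h0 : 0 < α) (h1 : α < 1)
    (hv : ∀ n : ℤ, (v n = true ↔ Int.fract ((n : ℝ) * α + β) ∈ Set.Ico (1 - α) 1)) (n : ℤ) :
    ⌊((n + 1 : ℤ) : ℝ) * α + β⌋ = ⌊(n : ℝ) * α + β⌋ + (if v n = true then 1 else 0) := by
  have e1 := Int.floor_add_fract ((n : ℝ) * α + β)
  have e2 := Int.fract_nonneg ((n : ℝ) * α + β)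
  have e3 := Int.fract_lt_one ((n : ℝ) * α + β)
  rw [Int.floor_eq_iff]
  by_cases h : v n = true
  · have h' := (hv n).1 h
    rw [if_pos h]
    push_cast
    constructor
    · linarith [h'.1]
    · linarith
  · rw [if_neg h]
    have h' : Int.fract ((n : ℝ) * α + β) < 1 - α := by
      by_contra hh
      exact h ((hv n).2 ⟨not_lt.1 hh, e3⟩)
    push_cast
    constructor
    · linarith
    · linarith

theorem cnt_eq {v : ℤ → Bool} {α β : ℝ} (h0 : 0 < α) (h1 : α < 1)
    (hv : ∀ n : ℤ, (v n = true ↔ Int.fract ((n : ℝ) * α + β) ∈ Set.Ico (1 - α) 1)) (n : ℕ) :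
    ((((List.range n).map (fun i : ℕ => v i)).count true : ℕ) : ℤ)
      = ⌊(n : ℝ) * α + β⌋ - ⌊β⌋ := by
  induction n with
  | zero => simp
  | succ n ih =>
    rw [List.range_succ, List.map_append, List.count_append]
    have := letter_iff h0 h1 hv n
    push_cast at this ⊢
    rw [ih, this]
    by_cases h : v n = true <;> (simp [h]; try ring)

theorem cnt_close {v : ℤ → Bool} {α β : ℝ} (h0 : 0 < α) (h1 : α < 1)
    (hv : ∀ n : ℤ, (v n = true ↔ Int.fract ((n : ℝ) * α + β) ∈ Set.Ico (1 - α) 1)) (n : ℕ) :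
    |((((List.range n).map (fun i : ℕ => v i)).count true : ℕ) : ℝ) - n * α| ≤ 1 := by
  have h := cnt_eq h0 h1 hv n
  have h' : ((((List.range n).map (fun i : ℕ => v i)).count true : ℕ) : ℝ)
      = ((⌊(n : ℝ) * α + β⌋ : ℤ) : ℝ) - ((⌊β⌋ : ℤ) : ℝ) := by
    exact_mod_cast h
  rw [h', abs_le]
  have a1 := Int.floor_le ((n : ℝ) * α + β)
  have a2 := Int.lt_floor_add_one ((n : ℝ) * α + β)
  have b1 := Int.floor_le β
  have b2 := Int.lt_floor_add_one β
  constructor <;> linarith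

theorem applySubst_length (s : Bool → List Bool) (w : List Bool) :
    (applySubst s w).length + (s false).length * w.count true
      = (s false).length * w.length + (s true).length * w.count true := by
  induction w with
  | nil => simp [applySubst]
  | cons b w ih =>
    simp only [applySubst, List.flatMap_cons, List.length_append] at ih ⊢
    cases b
    · simp only [List.length_cons, List.count_cons]
      simp [-List.length_flatMap]
      linarith
    · simp only [List.length_cons, List.count_cons]
      simp [-List.length_flatMap]
      linarith

theorem applySubst_count (s : Bool → List Bool) (w : List Bool) :
    (applySubst s w).count true + (s false).count true * w.count true
      = (s false).count true * w.length + (s true).count true * w.count true := by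
  induction w with
  | nil => simp [applySubst]
  | cons b w ih =>
    simp only [applySubst, List.flatMap_cons, List.count_append] at ih ⊢
    cases b
    · simp only [List.length_cons, List.count_cons]
      simp
      linarith
    · simp only [List.length_cons, List.count_cons]
      simp
      linarith

theorem seqPrefix_eq (w : List Bool) (u : ℕ → Bool) (h : SeqPrefix w u) :
    w = (List.range w.length).map u := by
  apply List.ext_get
  · simp
  · intro n h1 h2
    rw [h n h1]
    simp

theorem alpha_quadratic {s : Bool → List Bool} {v : ℤ → Bool} {α β : ℝ} (h0 : 0 < α) (h1 : α < 1)
    (hv : ∀ n : ℤ, (v n = true ↔ Int.fract ((n : ℝ) * α + β) ∈ Set.Ico (1 - α) 1))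
    (hfix : FixedPointOfSubst s (fun n : ℕ => v (n : ℤ))) :
    (((s true).length : ℝ) - (s false).length) * α ^ 2
      + (((s false).length : ℝ) + (s false).count true - (s true).count true) * α
      - (s false).count true = 0 := by
  set l0 : ℝ := ((s false).length : ℝ)
  set l1 : ℝ := ((s true).length : ℝ)
  set a0 : ℝ := ((s false).count true : ℝ)
  set a1 : ℝ := ((s true).count true : ℝ)
  set D := (l1 - l0) * α ^ 2 + (l0 + a0 - a1) * α - a0 with hD
  have key : ∀ m : ℕ, |(m : ℝ) * D| ≤ 1 + |a1 - a0 - α * (l1 - l0)| := by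
    intro m
    set c := ((List.range m).map (fun i : ℕ => v i)).count true with hc
    have hp := seqPrefix_eq _ _ (hfix m)
    have e1 := applySubst_length s ((List.range m).map (fun i : ℕ => v i))
    have e2 := applySubst_count s ((List.range m).map (fun i : ℕ => v i))
    set W := applySubst s ((List.range m).map (fun i : ℕ => v i)) with hW
    have e3 := cnt_close h0 h1 hv W.length
    rw [← hp] at e3
    have e4 := cnt_close h0 h1 hv m
    rw [← hc] at e1 e2 e4
    simp only [List.length_map, List.length_range] at e1 e2
    have e1' : (W.length : ℝ) = l0 * m + l1 * c - l0 * c := by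
      have : (W.length : ℝ) + l0 * c = l0 * m + l1 * c := by simp only [l0, l1]; exact_mod_cast e1
      linarith
    have e2' : (W.count true : ℝ) = a0 * m + a1 * c - a0 * c := by
      have : (W.count true : ℝ) + a0 * c = a0 * m + a1 * c := by simp only [a0, a1]; exact_mod_cast e2
      linarith
    rw [e1', e2'] at e3
    have : (m : ℝ) * D = -(a0 * m + a1 * c - a0 * c - (l0 * m + l1 * c - l0 * c) * α)
        + (a1 - a0 - α * (l1 - l0)) * (c - m * α) := by rw [hD]; ring
    rw [this]
    refine (abs_add_le _ _).trans ?_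
    rw [abs_neg, abs_mul]
    have := mul_le_mul_of_nonneg_left e4 (abs_nonneg (a1 - a0 - α * (l1 - l0)))
    linarith
  by_contra hne
  obtain ⟨m, hm⟩ := exists_nat_gt ((1 + |a1 - a0 - α * (l1 - l0)|) / |D|)
  have hDp : 0 < |D| := abs_pos.2 hne
  rw [div_lt_iff₀ hDp] at hm
  have := key m
  rw [abs_mul, Nat.abs_cast] at this
  linarith

theorem count_pos {s : Bool → List Bool} (hp : IsPrimitiveInvertibleSubst s) :
    (s false).count true ≠ 0 := by
  intro h
  have h' : true ∉ s false := by
    intro hm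
    exact absurd h (List.count_pos_iff.2 hm).ne'
  obtain ⟨k, hk⟩ := hp.primitive
  have : ∀ j, true ∉ substPow s j false := by
    intro j
    induction j with
    | zero => simp [substPow]
    | succ j ih =>
      simp only [substPow, applySubst, List.mem_flatMap, not_exists, not_and]
      intro b hb
      cases b
      · exact h'
      · exact absurd hb ih
  exact this k (hk false true)

open Polynomial in
theorem alpha_badly {s : Bool → List Bool} {v : ℤ → Bool} {α β : ℝ} (h0 : 0 < α) (h1 : α < 1)
    (hirr : Irrational α) (hp : IsPrimitiveInvertibleSubst s)
    (hv : ∀ n : ℤ, (v n = true ↔ Int.fract ((n : ℝ) * α + β) ∈ Set.Ico (1 - α) 1))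
    (hfix : FixedPointOfSubst s (fun n : ℕ => v (n : ℤ))) :
    ∃ A : ℝ, 0 < A ∧ ∀ a b : ℤ, 0 < b → 1 ≤ (b : ℝ) ^ 2 * (|α - a / b| * A) := by
  have hq := alpha_quadratic h0 h1 hv hfix
  have hc := count_pos hp
  set f : ℤ[X] := C (((s true).length : ℤ) - (s false).length) * X ^ 2
      + C (((s false).length : ℤ) + (s false).count true - (s true).count true) * X
      + C (-((s false).count true : ℤ)) with hf
  have hf0 : f ≠ 0 := by
    intro h
    have : f.coeff 0 = 0 := by rw [h]; simp
    rw [hf] at this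
    simp at this
    exact hc this
  have hdeg : f.natDegree ≤ 2 := by
    rw [hf]; exact natDegree_quadratic_le
  have hev : eval α (map (algebraMap ℤ ℝ) f) = 0 := by
    rw [hf]
    simp only [Polynomial.map_add, Polynomial.map_mul, map_C, Polynomial.map_pow, map_X, eval_add,
      eval_mul, eval_C, eval_pow, eval_X]
    simp only [algebraMap_int_eq, eq_intCast]
    push_cast
    linarith
  obtain ⟨A, hA, h⟩ := Liouville.exists_pos_real_of_irrational_root hirr hf0 hev
  refine ⟨A, hA, fun a b hb => ?_⟩
  obtain ⟨n, rfl⟩ : ∃ n : ℕ, b = n + 1 := ⟨(b - 1).toNat, by omega⟩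
  have := h a n
  push_cast
  refine this.trans ?_
  refine mul_le_mul_of_nonneg_right ?_ (by positivity)
  exact pow_le_pow_right₀ (by linarith [(Nat.cast_nonneg n : (0:ℝ) ≤ n)]) hdeg

/-! ### The Stern-Brocot path -/

noncomputable section

/-- Stern-Brocot path of `α`, pairs `(a, b), (c, d)` with `a / b < α < c / d`. -/
def sb (α : ℝ) : ℕ → (ℤ × ℤ) × (ℤ × ℤ)
  | 0 => ((0, 1), (1, 1))
  | k + 1 =>
    if α * (((sb α k).1.2 : ℝ) + (sb α k).2.2) < ((sb α k).1.1 : ℝ) + (sb α k).2.1 then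
      ((sb α k).1, ((sb α k).1.1 + (sb α k).2.1, (sb α k).1.2 + (sb α k).2.2))
    else (((sb α k).1.1 + (sb α k).2.1, (sb α k).1.2 + (sb α k).2.2), (sb α k).2)

/-- Directions of the Stern-Brocot path. -/
def sbDir (α : ℝ) (k : ℕ) : Bool :=
  decide (α * (((sb α k).1.2 : ℝ) + (sb α k).2.2) < ((sb α k).1.1 : ℝ) + (sb α k).2.1)

theorem sb_true {α : ℝ} {k : ℕ} (h : sbDir α k = true) :
    sb α (k + 1) = ((sb α k).1, ((sb α k).1.1 + (sb α k).2.1, (sb α k).1.2 + (sb α k).2.2)) := by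
  rw [sbDir, decide_eq_true_iff] at h
  rw [sb, if_pos h]

theorem sb_false {α : ℝ} {k : ℕ} (h : sbDir α k = false) :
    sb α (k + 1) = (((sb α k).1.1 + (sb α k).2.1, (sb α k).1.2 + (sb α k).2.2), (sb α k).2) := by
  rw [sbDir, decide_eq_false_iff_not] at h
  rw [sb, if_neg h]

/-- Invariants of the Stern-Brocot path. -/
structure SBInv (α : ℝ) (k : ℕ) (t : (ℤ × ℤ) × (ℤ × ℤ)) : Prop where
  hb : 0 < t.1.2
  hd : 0 < t.2.2
  hdet : t.1.2 * t.2.1 - t.1.1 * t.2.2 = 1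
  hl : (t.1.1 : ℝ) < t.1.2 * α
  hr : (t.2.2 : ℝ) * α < t.2.1
  hsz : (k : ℤ) + 2 ≤ t.1.2 + t.2.2

theorem sb_inv {α : ℝ} (h0 : 0 < α) (h1 : α < 1) (hirr : Irrational α) (k : ℕ) :
    SBInv α k (sb α k) := by
  induction k with
  | zero => constructor <;> simp [sb, h0, h1]
  | succ k ih =>
    obtain ⟨hb, hd, hdet, hl, hr, hsz⟩ := ih
    cases h : sbDir α k
    · rw [sb_false h]
      rw [sbDir, decide_eq_false_iff_not, not_lt] at h
      constructor
      · simp only; omega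
      · exact hd
      · simp only; linarith
      · simp only
        push_cast
        refine lt_of_le_of_ne (by linarith) ?_
        intro he
        have hpos : (0 : ℝ) < ((sb α k).1.2 : ℝ) + (sb α k).2.2 := by exact_mod_cast by omega
        apply hirr
        refine ⟨(((sb α k).1.1 + (sb α k).2.1 : ℤ) : ℚ) / (((sb α k).1.2 + (sb α k).2.2 : ℤ) : ℚ), ?_⟩
        push_cast
        rw [he]
        field_simp
      · exact hr
      · simp only; push_cast; omega
    · rw [sb_true h]
      rw [sbDir, decide_eq_true_iff] at h
      constructor
      · exact hb
      · simp only; omega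
      · simp only; linarith
      · exact hl
      · simp only
        push_cast
        linarith
      · simp only; push_cast; omega

theorem sb_run_true {α : ℝ} {k J : ℕ} (h : ∀ j < J, sbDir α (k + j) = true) :
    ∀ j ≤ J, sb α (k + j) = ((sb α k).1, ((sb α k).2.1 + j * (sb α k).1.1,
      (sb α k).2.2 + j * (sb α k).1.2)) := by
  intro j
  induction j with
  | zero => intro _; simp
  | succ j ih =>
    intro hj
    rw [← add_assoc, sb_true (h j (by omega)), ih (by omega)]
    ext <;> simp <;> ring

theorem sb_run_false {α : ℝ} {k J : ℕ} (h : ∀ j < J, sbDir α (k + j) = false) :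
    ∀ j ≤ J, sb α (k + j) = (((sb α k).1.1 + j * (sb α k).2.1,
      (sb α k).1.2 + j * (sb α k).2.2), (sb α k).2) := by
  intro j
  induction j with
  | zero => intro _; simp
  | succ j ih =>
    intro hj
    rw [← add_assoc, sb_false (h j (by omega)), ih (by omega)]
    ext <;> simp <;> ring

theorem sb_bounded {α : ℝ} (h0 : 0 < α) (h1 : α < 1) (hirr : Irrational α) {A : ℝ} (hA : 0 < A)
    (hbad : ∀ a b : ℤ, 0 < b → 1 ≤ (b : ℝ) ^ 2 * (|α - a / b| * A)) :
    ∃ K : ℕ, (∀ k, ∃ j ≤ K, sbDir α (k + j) = false) ∧ (∀ k, ∃ j ≤ K, sbDir α (k + j) = true) := by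
  obtain ⟨K, hK⟩ := exists_nat_gt A
  refine ⟨K, fun k => ?_, fun k => ?_⟩
  · by_contra hcon
    push Not at hcon
    have hrun := sb_run_true (α := α) (k := k) (J := K)
      (fun j hj => by simpa using hcon j hj.le) K le_rfl
    have hi := sb_inv h0 h1 hirr (k + K)
    rw [hrun] at hi
    have hr := hi.hr
    simp only at hr
    push_cast at hr
    obtain ⟨hb, hd, hdet, hl, -, -⟩ := sb_inv h0 h1 hirr k
    set a := (sb α k).1.1
    set b := (sb α k).1.2
    set c := (sb α k).2.1
    set d := (sb α k).2.2
    have hb' : (0 : ℝ) < b := by exact_mod_cast hb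
    have hd' : (0 : ℝ) < d := by exact_mod_cast hd
    have hdet' : (b : ℝ) * c - a * d = 1 := by exact_mod_cast hdet
    have hba := hbad a b hb
    have hx : 0 < b * α - a := by linarith
    have e : (b : ℝ) ^ 2 * (|α - a / b| * A) = b * (b * α - a) * A := by
      have : α - a / b = (b * α - a) / b := by field_simp
      rw [this, abs_of_pos (by positivity)]
      field_simp
    rw [e] at hba
    have h2 : (d + K * b) * (b * α - a) < 1 := by nlinarith
    have h3 : (K : ℝ) * (b * (b * α - a)) < 1 := by nlinarith
    have h4 : (K : ℝ) * 1 ≤ K * (b * (b * α - a) * A) :=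
      mul_le_mul_of_nonneg_left hba (Nat.cast_nonneg _)
    nlinarith
  · by_contra hcon
    push Not at hcon
    have hrun := sb_run_false (α := α) (k := k) (J := K)
      (fun j hj => by simpa using hcon j hj.le) K le_rfl
    have hi := sb_inv h0 h1 hirr (k + K)
    rw [hrun] at hi
    have hr := hi.hl
    simp only at hr
    push_cast at hr
    obtain ⟨hb, hd, hdet, -, hr', -⟩ := sb_inv h0 h1 hirr k
    set a := (sb α k).1.1
    set b := (sb α k).1.2
    set c := (sb α k).2.1
    set d := (sb α k).2.2
    have hb' : (0 : ℝ) < b := by exact_mod_cast hb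
    have hd' : (0 : ℝ) < d := by exact_mod_cast hd
    have hdet' : (b : ℝ) * c - a * d = 1 := by exact_mod_cast hdet
    have hba := hbad c d hd
    have hx : 0 < c - d * α := by linarith
    have e : (d : ℝ) ^ 2 * (|α - c / d| * A) = d * (c - d * α) * A := by
      have : α - c / d = - ((c - d * α) / d) := by field_simp; ring
      rw [this, abs_neg, abs_of_pos (by positivity)]
      field_simp
    rw [e] at hba
    have h2 : (b + K * d) * (c - d * α) < 1 := by nlinarith
    have h3 : (K : ℝ) * (d * (c - d * α)) < 1 := by nlinarith
    have h4 : (K : ℝ) * 1 ≤ K * (d * (c - d * α) * A) :=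
      mul_le_mul_of_nonneg_left hba (Nat.cast_nonneg _)
    nlinarith

theorem sb_mediant {α : ℝ} (h0 : 0 < α) (h1 : α < 1) (hirr : Irrational α) (k : ℕ) :
    |α - ((((sb α k).1.1 + (sb α k).2.1 : ℤ) : ℝ) / (((sb α k).1.2 + (sb α k).2.2 : ℤ) : ℝ))|
      ≤ 1 / (k + 1) := by
  obtain ⟨hb, hd, hdet, hl, hr, hsz⟩ := sb_inv h0 h1 hirr k
  set a := (sb α k).1.1
  set b := (sb α k).1.2
  set c := (sb α k).2.1
  set d := (sb α k).2.2
  have hb' : (1 : ℝ) ≤ b := by exact_mod_cast hb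
  have hd' : (1 : ℝ) ≤ d := by exact_mod_cast hd
  have hdet' : (b : ℝ) * c - a * d = 1 := by exact_mod_cast hdet
  have hsz' : (k : ℝ) + 2 ≤ b + d := by exact_mod_cast hsz
  have hk : (k : ℝ) + 1 ≤ b * d := by nlinarith
  have hk0 : (0 : ℝ) ≤ k := Nat.cast_nonneg k
  have hle : 1 / ((b : ℝ) * d) ≤ 1 / (k + 1) := one_div_le_one_div_of_le (by linarith) hk
  refine le_trans ?_ hle
  have l1 : (a : ℝ) / b < α := by rw [div_lt_iff₀ (by linarith)]; linarith
  have l2 : α < (c : ℝ) / d := by rw [lt_div_iff₀ (by linarith)]; linarith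
  have m1 : (a : ℝ) / b ≤ ((a + c : ℤ) : ℝ) / ((b + d : ℤ) : ℝ) := by
    push_cast
    rw [div_le_div_iff₀ (by linarith) (by linarith)]; nlinarith
  have m2 : ((a + c : ℤ) : ℝ) / ((b + d : ℤ) : ℝ) ≤ (c : ℝ) / d := by
    push_cast
    rw [div_le_div_iff₀ (by linarith) (by linarith)]; nlinarith
  have e : (c : ℝ) / d - a / b = 1 / (b * d) := by
    have : (b : ℝ) ≠ 0 := by linarith
    have : (d : ℝ) ≠ 0 := by linarith
    field_simp
    linarith
  rw [abs_le]
  constructor <;> linarith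

/-! ### Words and transfer matrices -/

/-- The `n`-th letter of the rational rotation word of slope `p / q`. -/
def letter (p q n : ℤ) : Bool := decide ((n + 1) * p / q = n * p / q + 1)

theorem floor_left {a b c d n : ℤ} (hb : 0 < b) (hd : 0 < d) (hdet : b * c - a * d = 1)
    (hn0 : 0 ≤ n) (hn : n ≤ b) : n * (a + c) / (b + d) = n * a / b := by
  have e := Int.mul_ediv_add_emod (n * a) b
  have r0 := Int.emod_nonneg (n * a) hb.ne'
  have r1 := Int.emod_lt_of_pos (n * a) hb
  set f := n * a / b
  set r := n * a % b
  have key : b * (n * (a + c)) = b * (f * (b + d)) + (r * (b + d) + n) := by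
    have : b * c = 1 + a * d := by linarith
    calc b * (n * (a + c)) = n * a * b + n * (b * c) := by ring
      _ = n * a * (b + d) + n := by rw [this]; ring
      _ = _ := by rw [← e]; ring
  apply le_antisymm
  · refine Int.lt_add_one_iff.1 (Int.ediv_lt_of_lt_mul (by omega) ?_)
    refine lt_of_mul_lt_mul_left ?_ hb.le
    rw [key]
    nlinarith
  · refine Int.le_ediv_of_mul_le (by omega) ?_
    refine le_of_mul_le_mul_left ?_ hb
    rw [key]
    nlinarith

theorem floor_right {a b c d n : ℤ} (hb : 0 < b) (hd : 0 < d) (hdet : b * c - a * d = 1)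
    (hn0 : 0 ≤ n) (hn : n ≤ d) : (b + n) * (a + c) / (b + d) = a + n * c / d := by
  have e := Int.mul_ediv_add_emod (n * c) d
  have r0 := Int.emod_nonneg (n * c) hd.ne'
  have r1 := Int.emod_lt_of_pos (n * c) hd
  set f := n * c / d
  set r := n * c % d
  have key : d * ((b + n) * (a + c)) = d * ((a + f) * (b + d)) + (r * (b + d) + (d - n)) := by
    have h1 : b * c = 1 + a * d := by linarith
    calc d * ((b + n) * (a + c)) = d * b * a + d * (b * c) + n * a * d + n * c * d := by ring
      _ = d * b * a + d * (1 + a * d) + n * (b * c - 1) + n * c * d := by rw [h1]; ring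
      _ = d * b * a + d * (1 + a * d) + (n * c) * (b + d) - n := by ring
      _ = _ := by rw [← e]; ring
  apply le_antisymm
  · refine Int.lt_add_one_iff.1 (Int.ediv_lt_of_lt_mul (by omega) ?_)
    refine lt_of_mul_lt_mul_left ?_ hd.le
    rw [key]
    nlinarith
  · refine Int.le_ediv_of_mul_le (by omega) ?_
    refine le_of_mul_le_mul_left ?_ hd
    rw [key]
    nlinarith

/-- One-step transfer matrices. -/
def tmat (p q E : ℝ) (b : Bool) : Matrix (Fin 2) (Fin 2) ℝ :=
  if b then !![(E - q) / p, -p; 1 / p, 0] else !![E, -1; 1, 0]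

/-- Transfer matrix of the first `n` letters of `u`. -/
def tmprod (M : Bool → Matrix (Fin 2) (Fin 2) ℝ) (u : ℕ → Bool) : ℕ → Matrix (Fin 2) (Fin 2) ℝ
  | 0 => 1
  | n + 1 => M (u n) * tmprod M u n

theorem tmprod_add (M : Bool → Matrix (Fin 2) (Fin 2) ℝ) (u : ℕ → Bool) (m n : ℕ) :
    tmprod M u (m + n) = tmprod M (fun i => u (m + i)) n * tmprod M u m := by
  induction n with
  | zero => simp [tmprod]
  | succ n ih => rw [← add_assoc, tmprod, ih, tmprod, mul_assoc]

theorem tmprod_congr (M : Bool → Matrix (Fin 2) (Fin 2) ℝ) (u u' : ℕ → Bool) (n : ℕ)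
    (h : ∀ i < n, u i = u' i) : tmprod M u n = tmprod M u' n := by
  induction n with
  | zero => rfl
  | succ n ih => rw [tmprod, tmprod, ih (fun i hi => h i (by omega)), h n (by omega)]

/-- Transfer matrix over a period of the word of slope `p / q`. -/
def Cmat (M : Bool → Matrix (Fin 2) (Fin 2) ℝ) (p q : ℤ) : Matrix (Fin 2) (Fin 2) ℝ :=
  tmprod M (fun n : ℕ => letter p q n) q.toNat

theorem Cmat_mediant (M : Bool → Matrix (Fin 2) (Fin 2) ℝ) {a b c d : ℤ} (hb : 0 < b) (hd : 0 < d)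
    (hdet : b * c - a * d = 1) : Cmat M (a + c) (b + d) = Cmat M c d * Cmat M a b := by
  rw [Cmat, Cmat, Cmat, Int.toNat_add hb.le hd.le, tmprod_add]
  congr 1
  · apply tmprod_congr
    intro i hi
    simp only [letter]
    push_cast
    rw [Int.toNat_of_nonneg hb.le, add_assoc b (i : ℤ) 1,
      floor_right hb hd hdet (by omega) (by omega), floor_right hb hd hdet (by omega) (by omega)]
    congr 1
    apply propext
    constructor <;> intro h <;> linarith
  · apply tmprod_congr
    intro i hi
    simp only [letter]
    rw [floor_left hb hd hdet (by omega) (by omega), floor_left hb hd hdet (by omega) (by omega)]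

theorem trace_sq_mul_left (A B : Matrix (Fin 2) (Fin 2) ℝ) (hA : A.det = 1) :
    (B * A * A).trace = A.trace * (B * A).trace - B.trace := by
  rw [Matrix.det_fin_two] at hA
  simp only [Matrix.trace_fin_two, Matrix.mul_apply, Fin.sum_univ_two]
  linear_combination (-(B 0 0) - B 1 1) * hA

theorem trace_sq_mul_right (A B : Matrix (Fin 2) (Fin 2) ℝ) (hB : B.det = 1) :
    (B * (B * A)).trace = B.trace * (B * A).trace - A.trace := by
  rw [Matrix.det_fin_two] at hB
  simp only [Matrix.trace_fin_two, Matrix.mul_apply, Fin.sum_univ_two]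
  linear_combination (-(A 0 0) - A 1 1) * hB

theorem tmat_det {p : ℝ} (hp : p ≠ 0) (q E : ℝ) (b : Bool) : (tmat p q E b).det = 1 := by
  cases b <;> simp [tmat, Matrix.det_fin_two, hp]

theorem tmprod_det {M : Bool → Matrix (Fin 2) (Fin 2) ℝ} (hM : ∀ b, (M b).det = 1) (u : ℕ → Bool)
    (n : ℕ) : (tmprod M u n).det = 1 := by
  induction n with
  | zero => simp [tmprod]
  | succ n ih => rw [tmprod, Matrix.det_mul, hM, ih, one_mul]

open Polynomial in
theorem polySt_trace {α : ℝ} (h0 : 0 < α) (h1 : α < 1) (hirr : Irrational α) {p : ℝ} (hp : p ≠ 0)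
    (q E : ℝ) (k : ℕ) :
    (Cmat (tmat p q E) (sb α k).1.1 (sb α k).1.2).trace = (polySt p q (sbDir α) k).1.eval E ∧
    (Cmat (tmat p q E) (sb α k).2.1 (sb α k).2.2).trace = (polySt p q (sbDir α) k).2.1.eval E ∧
    (Cmat (tmat p q E) ((sb α k).1.1 + (sb α k).2.1) ((sb α k).1.2 + (sb α k).2.2)).trace =
      ((polySt p q (sbDir α) k).1 * (polySt p q (sbDir α) k).2.1
        - (polySt p q (sbDir α) k).2.2).eval E := by
  have hM := tmat_det hp q E
  have hC : ∀ a b, (Cmat (tmat p q E) a b).det = 1 := fun a b => tmprod_det hM _ _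
  induction k with
  | zero =>
    rw [Cmat_mediant _ (by simp [sb]) (by simp [sb]) (by simp [sb])]
    simp [sb, Cmat, polySt, tmprod, letter, tmat, Matrix.trace_fin_two, Matrix.mul_apply]
    constructor
    · ring
    · ring
  | succ k ih =>
    obtain ⟨i1, i2, i3⟩ := ih
    have hi := sb_inv h0 h1 hirr k
    have hi' := sb_inv h0 h1 hirr (k + 1)
    have hmed := Cmat_mediant (tmat p q E) hi.hb hi.hd hi.hdet
    have hmed' := Cmat_mediant (tmat p q E) hi'.hb hi'.hd hi'.hdet
    rw [hmed']
    rw [hmed] at i3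
    cases h : sbDir α k
    · rw [sb_false h]
      simp only [polySt, h]
      simp only [hmed]
      refine ⟨i3, i2, ?_⟩
      rw [trace_sq_mul_right _ _ (hC _ _), i1, i2, i3]
      simp
      try ring
    · rw [sb_true h]
      simp only [polySt, h]
      simp only [hmed]
      refine ⟨i1, i3, ?_⟩
      rw [trace_sq_mul_left _ _ (hC _ _), i1, i2, i3]
      simp

end

open Filter Topology

/-! ### The Jacobi operator and approximate eigenvectors -/

noncomputable section

theorem shift_sum_le (c : ℤ → ℂ) (B : ℝ) (hB : 0 ≤ B) (hc : ∀ n, ‖c n‖ ≤ B) (k : ℤ)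
    (φ : JacobiSpace) (s : Finset ℤ) :
    ∑ i ∈ s, ‖c i * φ (i + k)‖ ^ (ENNReal.toReal 2) ≤ (B * ‖φ‖) ^ (ENNReal.toReal 2) := by
  have h2 : ENNReal.toReal 2 = 2 := by norm_num
  have h := lp.sum_rpow_le_norm_rpow (p := 2) (by norm_num) φ (s.map (addRightEmbedding k))
  rw [Finset.sum_map] at h
  rw [h2] at h ⊢
  simp only [addRightEmbedding_apply, Real.rpow_two] at h ⊢
  rw [mul_pow]
  calc ∑ i ∈ s, ‖c i * φ (i + k)‖ ^ 2 ≤ ∑ i ∈ s, B ^ 2 * ‖φ (i + k)‖ ^ 2 := by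
        apply Finset.sum_le_sum
        intro i _
        rw [norm_mul, mul_pow]
        have := hc i
        gcongr
    _ = B ^ 2 * ∑ i ∈ s, ‖φ (i + k)‖ ^ 2 := by rw [Finset.mul_sum]
    _ ≤ _ := by gcongr

theorem exists_shift_op (c : ℤ → ℂ) (B : ℝ) (hB : 0 ≤ B) (hc : ∀ n, ‖c n‖ ≤ B) (k : ℤ) :
    ∃ T : JacobiSpace →L[ℂ] JacobiSpace, ∀ φ : JacobiSpace, ∀ n : ℤ, T φ n = c n * φ (n + k) := by
  have hmem : ∀ φ : JacobiSpace, Memℓp (fun n : ℤ => c n * φ (n + k)) 2 := fun φ =>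
    memℓp_gen' (shift_sum_le c B hB hc k φ)
  let T0 : JacobiSpace →ₗ[ℂ] JacobiSpace :=
    { toFun := fun φ => ⟨fun n => c n * φ (n + k), hmem φ⟩
      map_add' := by
        intro φ ψ
        ext n
        exact mul_add _ _ _
      map_smul' := by
        intro a φ
        ext n
        simp
        ring }
  refine ⟨T0.mkContinuous B ?_, ?_⟩
  · intro φ
    exact lp.norm_le_of_forall_sum_le (by norm_num) (by positivity) (shift_sum_le c B hB hc k φ)
  · intro φ n
    rfl

theorem shift_adjoint (c c' : ℤ → ℂ) (k k' : ℤ) (hk : k' = -k)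
    (hc : ∀ n, c' n = star (c (n - k)))
    (T T' : JacobiSpace →L[ℂ] JacobiSpace) (hT : ∀ φ : JacobiSpace, ∀ n : ℤ, T φ n = c n * φ (n + k))
    (hT' : ∀ φ : JacobiSpace, ∀ n : ℤ, T' φ n = c' n * φ (n + k')) (φ ψ : JacobiSpace) :
    inner ℂ (T φ) ψ = inner ℂ φ (T' ψ) := by
  rw [lp.inner_eq_tsum, lp.inner_eq_tsum, ← (Equiv.addRight k).tsum_eq (fun n => inner ℂ (φ n) (T' ψ n))]
  apply tsum_congr
  intro n
  simp only [Equiv.coe_addRight]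
  rw [hT, hT', hc, hk]
  simp
  ring

theorem exists_jacobi (p q : ℝ) (ω : ℤ → Bool) :
    ∃ H : JacobiSpace →L[ℂ] JacobiSpace, IsJacobi p q ω H ∧
      ∀ φ ψ : JacobiSpace, inner ℂ (H φ) ψ = inner ℂ φ (H ψ) := by
  have hp : ∀ b, ‖(pCoef p b : ℂ)‖ ≤ 1 + |p| := by
    intro b
    cases b <;> simp [pCoef]
  have hq : ∀ b, ‖(qCoef q b : ℂ)‖ ≤ |q| := by
    intro b
    cases b <;> simp [qCoef]
  obtain ⟨T1, h1⟩ := exists_shift_op (fun n => (pCoef p (ω (n + 1)) : ℂ)) (1 + |p|) (by positivity)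
    (fun n => hp _) 1
  obtain ⟨T2, h2⟩ := exists_shift_op (fun n => (pCoef p (ω n) : ℂ)) (1 + |p|) (by positivity)
    (fun n => hp _) (-1)
  obtain ⟨T3, h3⟩ := exists_shift_op (fun n => (qCoef q (ω n) : ℂ)) |q| (by positivity)
    (fun n => hq _) 0
  refine ⟨T1 + T2 + T3, ?_, ?_⟩
  · intro φ n
    have : ((T1 + T2 + T3) φ : ∀ _ : ℤ, ℂ) n = T1 φ n + T2 φ n + T3 φ n := rfl
    rw [this, h1, h2, h3]
    simp [sub_eq_add_neg]
  · intro φ ψ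
    have a1 := shift_adjoint _ _ 1 (-1) rfl (by intro n; simp) T1 T2 h1 h2 φ ψ
    have a2 := shift_adjoint _ _ (-1) 1 (by simp) (by intro n; simp) T2 T1 h2 h1 φ ψ
    have a3 := shift_adjoint _ _ 0 0 (by simp) (by intro n; simp) T3 T3 h3 h3 φ ψ
    simp only [add_apply, inner_add_left, inner_add_right, a1, a2, a3]
    ring

theorem approx_eig_abs (T : JacobiSpace →L[ℂ] JacobiSpace)
    (hsym : ∀ φ ψ : JacobiSpace, inner ℂ (T φ) ψ = inner ℂ φ (T ψ)) (hT : ¬ IsUnit T)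
    {ε : ℝ} (hε : 0 < ε) : ∃ ψ : JacobiSpace, ‖T ψ‖ < ε * ‖ψ‖ := by
  by_contra hcon
  push Not at hcon
  apply hT
  have : IsUnit (T ^ 2) := by
    refine ContinuousLinearMap.isUnit_of_forall_le_norm_inner_map (T ^ 2)
      (c := Real.toNNReal (ε ^ 2)) (by rw [Real.toNNReal_pos]; positivity) ?_
    intro x
    have e : inner ℂ ((T ^ 2) x) x = inner ℂ (T x) (T x) := by
      rw [pow_two]
      exact hsym (T x) x
    rw [e, inner_self_eq_norm_sq_to_K]
    have h := hcon x
    have h3 : (ε * ‖x‖) ^ 2 ≤ ‖T x‖ ^ 2 := by gcongr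
    rw [norm_pow, Real.coe_toNNReal _ (by positivity)]
    simp only [RCLike.norm_ofReal, abs_norm]
    linarith [mul_pow ε ‖x‖ 2]
  exact (isUnit_pow_iff (by norm_num)).1 this

theorem approx_eig_finite (T : JacobiSpace →L[ℂ] JacobiSpace) {ε : ℝ}
    (h : ∃ ψ : JacobiSpace, ‖T ψ‖ < ε * ‖ψ‖) :
    ∃ ψ : JacobiSpace, ∃ s : Finset ℤ, (∀ n ∉ s, ψ n = 0) ∧ ‖T ψ‖ < ε * ‖ψ‖ := by
  obtain ⟨ψ, hψ⟩ := h
  have hs := lp.hasSum_single (p := 2) (by norm_num) ψ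
  have hs' : Tendsto (fun s : Finset ℤ => ∑ i ∈ s, lp.single 2 i (ψ i)) atTop (𝓝 ψ) := hs
  have hc : Continuous (fun x : JacobiSpace => ε * ‖x‖ - ‖T x‖) := by fun_prop
  have ht := (hc.tendsto ψ).comp hs'
  have hev := ht.eventually (lt_mem_nhds (show 0 < ε * ‖ψ‖ - ‖T ψ‖ by linarith))
  obtain ⟨s, hs0⟩ := hev.exists
  have hs1 : 0 < ε * ‖∑ i ∈ s, lp.single 2 i (ψ i)‖ - ‖T (∑ i ∈ s, lp.single 2 i (ψ i))‖ := hs0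
  refine ⟨∑ i ∈ s, lp.single 2 i (ψ i), s, ?_, sub_pos.1 hs1⟩
  intro n hn
  rw [lp.coeFn_sum, Finset.sum_apply]
  apply Finset.sum_eq_zero
  intro i hi
  rw [lp.single_apply]
  have : n ≠ i := fun hh => hn (hh ▸ hi)
  simp [this]

/-- The real Jacobi expression `((J - E) f) n`. -/
def jac (p q E : ℝ) (ω : ℤ → Bool) (f : ℤ → ℝ) (n : ℤ) : ℝ :=
  pCoef p (ω (n + 1)) * f (n + 1) + pCoef p (ω n) * f (n - 1) + (qCoef q (ω n) - E) * f n

theorem approx_real {p q E : ℝ} {ω : ℤ → Bool} (hE : E ∈ jacobiSpectrum p q ω) {ε : ℝ}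
    (hε : 0 < ε) : ∃ (N : ℕ) (f : ℤ → ℝ), (∀ n : ℤ, (N : ℤ) < |n| → f n = 0) ∧
      ∑ n ∈ Finset.Icc (-(N : ℤ) - 1) (N + 1), (jac p q E ω f n) ^ 2
        < ε ^ 2 * ∑ n ∈ Finset.Icc (-(N : ℤ) - 1) (N + 1), f n ^ 2 := by
  obtain ⟨H, hH, hsym⟩ := exists_jacobi p q ω
  have hsp := hE H hH
  set T : JacobiSpace →L[ℂ] JacobiSpace := algebraMap ℂ _ (E : ℂ) - H with hTdef
  have hTx : ∀ x, T x = (E : ℂ) • x - H x := fun x => rfl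
  have hT : ¬ IsUnit T := hsp
  have hTsym : ∀ φ ψ : JacobiSpace, inner ℂ (T φ) ψ = inner ℂ φ (T ψ) := by
    intro φ ψ
    rw [hTx, hTx, inner_sub_left, inner_sub_right, hsym, inner_smul_left, inner_smul_right]
    simp
  obtain ⟨ψ, s, hs, hlt⟩ := approx_eig_finite T (approx_eig_abs T hTsym hT hε)
  obtain ⟨N, hN⟩ : ∃ N : ℕ, ∀ n ∈ s, |n| ≤ N := by
    refine ⟨(s.sup (fun n => n.natAbs)), fun n hn => ?_⟩
    have := Finset.le_sup (f := fun n : ℤ => n.natAbs) hn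
    rw [Int.abs_eq_natAbs]
    exact_mod_cast this
  have hz : ∀ n : ℤ, (N : ℤ) < |n| → ψ n = 0 := by
    intro n hn
    apply hs
    intro hh
    exact absurd (hN n hh) (not_le.2 hn)
  set I := Finset.Icc (-(N : ℤ) - 1) (N + 1) with hI
  have n1 : ‖ψ‖ ^ 2 = ∑ n ∈ I, ‖ψ n‖ ^ 2 := by
    have := lp.norm_rpow_eq_tsum (p := 2) (by norm_num) ψ
    simp only [ENNReal.toReal_ofNat, Real.rpow_two] at this
    rw [this]
    apply tsum_eq_sum
    intro n hn
    rw [hz n]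
    · simp
    · rw [hI, Finset.mem_Icc] at hn
      rw [lt_abs]
      omega
  have n2 : ∑ n ∈ I, ‖T ψ n‖ ^ 2 ≤ ‖T ψ‖ ^ 2 := by
    have := lp.sum_rpow_le_norm_rpow (p := 2) (by norm_num) (T ψ) I
    simpa only [ENNReal.toReal_ofNat, Real.rpow_two] using this
  have n3 : ‖T ψ‖ ^ 2 < ε ^ 2 * ‖ψ‖ ^ 2 := by
    rw [← mul_pow]
    exact pow_lt_pow_left₀ hlt (norm_nonneg _) (by norm_num)
  have hre : ∀ n, (T ψ n).re = - jac p q E ω (fun m => (ψ m).re) n := by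
    intro n
    have : T ψ n = (E : ℂ) * ψ n - H ψ n := rfl
    rw [this, hH ψ n]
    simp [jac]
    ring
  have him : ∀ n, (T ψ n).im = - jac p q E ω (fun m => (ψ m).im) n := by
    intro n
    have : T ψ n = (E : ℂ) * ψ n - H ψ n := rfl
    rw [this, hH ψ n]
    simp [jac]
    ring
  have key : ∑ n ∈ I, (jac p q E ω (fun m => (ψ m).re) n) ^ 2
      + ∑ n ∈ I, (jac p q E ω (fun m => (ψ m).im) n) ^ 2
      < ε ^ 2 * (∑ n ∈ I, (ψ n).re ^ 2) + ε ^ 2 * ∑ n ∈ I, (ψ n).im ^ 2 := by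
    rw [← mul_add, ← Finset.sum_add_distrib, ← Finset.sum_add_distrib]
    have e1 : ∀ n, ‖T ψ n‖ ^ 2 = (jac p q E ω (fun m => (ψ m).re) n) ^ 2
        + (jac p q E ω (fun m => (ψ m).im) n) ^ 2 := by
      intro n
      rw [Complex.sq_norm, Complex.normSq_apply, hre, him]
      ring
    have e2 : ∀ n, ‖ψ n‖ ^ 2 = (ψ n).re ^ 2 + (ψ n).im ^ 2 := by
      intro n
      rw [Complex.sq_norm, Complex.normSq_apply]
      ring
    simp only [e1] at n2
    simp only [e2] at n1
    rw [← n1]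
    linarith
  by_cases hc : ∑ n ∈ I, (jac p q E ω (fun m => (ψ m).re) n) ^ 2 < ε ^ 2 * ∑ n ∈ I, (ψ n).re ^ 2
  · exact ⟨N, fun m => (ψ m).re, fun n hn => by simp [hz n hn], hc⟩
  · refine ⟨N, fun m => (ψ m).im, fun n hn => by simp [hz n hn], ?_⟩
    show ∑ n ∈ I, (jac p q E ω (fun m => (ψ m).im) n) ^ 2 < ε ^ 2 * ∑ n ∈ I, (ψ n).im ^ 2
    linarith

end

open Filter Topology

/-! ### Periodic approximation -/

noncomputable section

theorem eig_exists {V : Type*} [NormedAddCommGroup V] [InnerProductSpace ℝ V]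
    [FiniteDimensional ℝ V] (T : V →ₗ[ℝ] V) (hT : T.IsSymmetric) (E ε : ℝ) (hε : 0 < ε) (f : V)
    (hf : ‖T f - E • f‖ < ε * ‖f‖) : ∃ (μ : ℝ) (φ : V), φ ≠ 0 ∧ T φ = μ • φ ∧ |μ - E| < ε := by
  by_contra hcon
  push Not at hcon
  set B := hT.eigenvectorBasis rfl with hB
  have hev : ∀ i, ε ≤ |hT.eigenvalues rfl i - E| := by
    intro i
    refine hcon _ (B i) ?_ ?_
    · exact B.orthonormal.ne_zero i
    · exact hT.apply_eigenvectorBasis rfl i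
  have h1 : (ε * ‖f‖) ^ 2 ≤ ‖T f - E • f‖ ^ 2 := by
    rw [mul_pow, ← B.repr.norm_map f, ← B.repr.norm_map (T f - E • f), EuclideanSpace.norm_sq_eq,
      EuclideanSpace.norm_sq_eq, Finset.mul_sum]
    apply Finset.sum_le_sum
    intro i _
    have e : (B.repr (T f - E • f)).ofLp i = (hT.eigenvalues rfl i - E) * (B.repr f).ofLp i := by
      rw [map_sub, map_smul]
      have := hT.eigenvectorBasis_apply_self_apply rfl f i
      simp only [PiLp.sub_apply, PiLp.smul_apply, smul_eq_mul]
      rw [hB, this]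
      simp
      ring
    rw [e, norm_mul, mul_pow]
    have := hev i
    rw [Real.norm_eq_abs (_ - _)]
    gcongr
  have h2 := abs_le_of_sq_le_sq h1 (norm_nonneg _)
  have h3 := le_abs_self (ε * ‖f‖)
  linarith

/-- Periodic Jacobi operator on the cyclic group. -/
def perOp (p q : ℝ) {Q : ℕ} [NeZero Q] (u : ZMod Q → Bool) :
    EuclideanSpace ℝ (ZMod Q) →ₗ[ℝ] EuclideanSpace ℝ (ZMod Q) where
  toFun f := WithLp.toLp 2 (fun z => pCoef p (u (z + 1)) * f (z + 1) + pCoef p (u z) * f (z - 1)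
    + qCoef q (u z) * f z)
  map_add' f g := by
    ext z
    simp
    ring
  map_smul' a f := by
    ext z
    simp
    ring

theorem perOp_apply (p q : ℝ) {Q : ℕ} [NeZero Q] (u : ZMod Q → Bool)
    (f : EuclideanSpace ℝ (ZMod Q)) (z : ZMod Q) :
    (perOp p q u f) z = pCoef p (u (z + 1)) * f (z + 1) + pCoef p (u z) * f (z - 1)
      + qCoef q (u z) * f z := rfl

theorem perOp_symm (p q : ℝ) {Q : ℕ} [NeZero Q] (u : ZMod Q → Bool) :
    (perOp p q u).IsSymmetric := by
  intro f g
  rw [PiLp.inner_apply, PiLp.inner_apply]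
  simp only [perOp_apply, RCLike.inner_apply, conj_trivial]
  simp only [mul_add, add_mul, Finset.sum_add_distrib]
  have e1 : ∀ f g : EuclideanSpace ℝ (ZMod Q),
      ∑ z : ZMod Q, g z * (pCoef p (u (z + 1)) * f (z + 1))
      = ∑ z : ZMod Q, g (z - 1) * (pCoef p (u z) * f z) := by
    intro f g
    rw [← Equiv.sum_comp (Equiv.addRight (1 : ZMod Q)) (fun z => g (z - 1) * (pCoef p (u z) * f z))]
    simp
  rw [e1 f g]
  have e2 := e1 g f
  have e3 : ∑ z : ZMod Q, pCoef p (u (z + 1)) * g (z + 1) * f z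
      = ∑ z : ZMod Q, f z * (pCoef p (u (z + 1)) * g (z + 1)) :=
    Finset.sum_congr rfl (fun z _ => by ring)
  rw [e3, e2]
  rw [add_comm (∑ z : ZMod Q, g (z - 1) * (pCoef p (u z) * f z))]
  congr 1
  · congr 1
    · exact Finset.sum_congr rfl (fun z _ => by ring)
    · exact Finset.sum_congr rfl (fun z _ => by ring)
  · exact Finset.sum_congr rfl (fun z _ => by ring)

theorem perOp_bound {p q μ : ℝ} (hp : |p| ≤ 1) {Q : ℕ} [NeZero Q] (u : ZMod Q → Bool)
    (φ : EuclideanSpace ℝ (ZMod Q)) (h0 : φ ≠ 0) (h : perOp p q u φ = μ • φ) :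
    |μ| ≤ 2 + |q| := by
  obtain ⟨z, -, hz⟩ := Finset.exists_max_image Finset.univ (fun z => |φ z|) ⟨0, Finset.mem_univ _⟩
  have hpos : 0 < |φ z| := by
    by_contra hc
    apply h0
    ext y
    have := hz y (Finset.mem_univ _)
    simp only [PiLp.zero_apply]
    rw [← abs_eq_zero]
    exact le_antisymm (by linarith) (abs_nonneg _)
  have hP : ∀ b, |pCoef p b| ≤ 1 := by
    intro b
    cases b <;> simp [pCoef, hp]
  have hQ : ∀ b, |qCoef q b| ≤ |q| := by
    intro b
    cases b <;> simp [qCoef]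
  have e : μ * φ z = pCoef p (u (z + 1)) * φ (z + 1) + pCoef p (u z) * φ (z - 1)
      + qCoef q (u z) * φ z := by
    rw [← perOp_apply, h]
    simp
  have e1 : |μ| * |φ z| ≤ (2 + |q|) * |φ z| := by
    rw [← abs_mul, e]
    refine (abs_add_three _ _ _).trans ?_
    rw [abs_mul, abs_mul, abs_mul]
    have a1 := mul_le_mul (hP (u (z + 1))) (hz (z + 1) (Finset.mem_univ _)) (abs_nonneg _) zero_le_one
    have a2 := mul_le_mul (hP (u z)) (hz (z - 1) (Finset.mem_univ _)) (abs_nonneg _) zero_le_one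
    have a3 := mul_le_mul_of_nonneg_right (hQ (u z)) (abs_nonneg (φ z))
    linarith
  exact le_of_mul_le_mul_right e1 hpos

theorem zmod_small {Q : ℕ} [NeZero Q] {M n : ℤ} (hQ : 2 * M < Q) (hn : |n| ≤ M) :
    ((n : ZMod Q)).valMinAbs = n := by
  rw [ZMod.valMinAbs_spec]
  rw [abs_le] at hn
  refine ⟨rfl, ?_, ?_⟩ <;> omega

theorem zmod_sum {Q : ℕ} [NeZero Q] (M : ℤ) (hQ : 2 * M < Q) (F : ZMod Q → ℝ)
    (hF : ∀ z, M < |z.valMinAbs| → F z = 0) :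
    ∑ z : ZMod Q, F z = ∑ n ∈ Finset.Icc (-M) M, F (n : ZMod Q) := by
  have hinj : Set.InjOn (fun n : ℤ => (n : ZMod Q)) (Finset.Icc (-M) M : Finset ℤ) := by
    intro a ha b hb hab
    simp only [Finset.coe_Icc, Set.mem_Icc] at ha hb
    have h1 := zmod_small hQ (abs_le.2 ha)
    have h2 := zmod_small hQ (abs_le.2 hb)
    simp only at hab
    rw [← h1, hab, h2]
  rw [← Finset.sum_image (f := F) hinj]
  symm
  apply Finset.sum_subset (Finset.subset_univ _)
  intro z _ hz
  apply hF
  by_contra hc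
  apply hz
  rw [Finset.mem_image]
  exact ⟨z.valMinAbs, Finset.mem_Icc.2 (abs_le.1 (not_lt.1 hc)), ZMod.coe_valMinAbs z⟩

theorem periodic_eig {p q E ε : ℝ} (hp : |p| ≤ 1) (hε : 0 < ε) {ω : ℤ → Bool} {N : ℕ} {f : ℤ → ℝ}
    (hf0 : ∀ n : ℤ, (N : ℤ) < |n| → f n = 0)
    (hf : ∑ n ∈ Finset.Icc (-(N : ℤ) - 1) (N + 1), (jac p q E ω f n) ^ 2
        < ε ^ 2 * ∑ n ∈ Finset.Icc (-(N : ℤ) - 1) (N + 1), f n ^ 2)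
    {Q : ℕ} [NeZero Q] (hQ : 2 * N + 10 ≤ Q) (u : ZMod Q → Bool)
    (hu : ∀ n : ℤ, |n| ≤ N + 2 → u n = ω n) :
    ∃ (μ : ℝ) (φ : EuclideanSpace ℝ (ZMod Q)), φ ≠ 0 ∧ perOp p q u φ = μ • φ ∧ |μ - E| < ε ∧
      |μ| ≤ 2 + |q| := by
  set g : EuclideanSpace ℝ (ZMod Q) := WithLp.toLp 2 (fun z => f z.valMinAbs) with hg
  have hgz : ∀ z, g z = f z.valMinAbs := fun z => rfl
  have hgn : ∀ n : ℤ, |n| ≤ N + 2 → g (n : ZMod Q) = f n := by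
    intro n hn
    rw [hgz, zmod_small (M := N + 2) (by omega) hn]
  have hI : Finset.Icc (-(N : ℤ) - 1) (N + 1) = Finset.Icc (-((N : ℤ) + 1)) (N + 1) := by
    congr 1
    ring
  rw [hI] at hf
  have s1 : ‖g‖ ^ 2 = ∑ n ∈ Finset.Icc (-((N : ℤ) + 1)) (N + 1), f n ^ 2 := by
    rw [EuclideanSpace.norm_sq_eq, zmod_sum ((N : ℤ) + 1) (by omega)]
    · apply Finset.sum_congr rfl
      intro n hn
      rw [Finset.mem_Icc, ← abs_le] at hn
      rw [hgn n (by omega)]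
      simp
    · intro z hz
      rw [hgz, hf0 _ (by omega)]
      simp
  have s2 : ‖perOp p q u g - E • g‖ ^ 2
      = ∑ n ∈ Finset.Icc (-((N : ℤ) + 1)) (N + 1), (jac p q E ω f n) ^ 2 := by
    rw [EuclideanSpace.norm_sq_eq, zmod_sum ((N : ℤ) + 1) (by omega)]
    · apply Finset.sum_congr rfl
      intro n hn
      rw [Finset.mem_Icc] at hn
      have e : (perOp p q u g - E • g) (n : ZMod Q) = jac p q E ω f n := by
        simp only [PiLp.sub_apply, PiLp.smul_apply, smul_eq_mul, perOp_apply]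
        have c1 : (n : ZMod Q) + 1 = ((n + 1 : ℤ) : ZMod Q) := by push_cast; rfl
        have c2 : (n : ZMod Q) - 1 = ((n - 1 : ℤ) : ZMod Q) := by push_cast; rfl
        rw [c1, c2, hgn n (abs_le.2 (by omega)), hgn (n + 1) (abs_le.2 (by omega)),
          hgn (n - 1) (abs_le.2 (by omega)), hu n (abs_le.2 (by omega)),
          hu (n + 1) (abs_le.2 (by omega)), jac]
        ring
      rw [e]
      simp
    · intro z hz
      have k : ∀ (y : ZMod Q) (t : ℤ), |t| ≤ 1 → z = y + (t : ZMod Q) → g y = 0 := by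
        intro y t ht hy
        rw [hgz]
        apply hf0
        by_contra hc
        rw [not_lt] at hc
        have : z = ((y.valMinAbs + t : ℤ) : ZMod Q) := by
          push_cast
          simpa using hy
        have hb : |y.valMinAbs + t| ≤ (N : ℤ) + 1 := (abs_add_le _ _).trans (by omega)
        rw [this, zmod_small (M := N + 1) (by omega) hb] at hz
        omega
      have z0 := k z 0 (by simp) (by simp)
      have z1 := k (z + 1) (-1) (by simp) (by simp)
      have z2 := k (z - 1) 1 (by simp) (by simp)
      simp only [PiLp.sub_apply, PiLp.smul_apply, smul_eq_mul, perOp_apply, z0, z1, z2]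
      simp
  have hlt : ‖perOp p q u g - E • g‖ < ε * ‖g‖ := by
    refine lt_of_pow_lt_pow_left₀ 2 (by positivity) ?_
    rw [mul_pow, s1, s2]
    exact hf
  obtain ⟨μ, φ, h0, h1, h2⟩ := eig_exists _ (perOp_symm p q u) E ε hε g hlt
  exact ⟨μ, φ, h0, h1, h2, perOp_bound hp u φ h0 h1⟩

theorem trace_eq_two (C : Matrix (Fin 2) (Fin 2) ℝ) (hC : C.det = 1) (w : Fin 2 → ℝ) (hw : w ≠ 0)
    (h : C.mulVec w = w) : C.trace = 2 := by
  have h1 : (C - 1).det = 0 := by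
    rw [← Matrix.exists_mulVec_eq_zero_iff]
    exact ⟨w, hw, by rw [Matrix.sub_mulVec, h, Matrix.one_mulVec, sub_self]⟩
  rw [Matrix.det_fin_two] at h1 hC
  rw [Matrix.trace_fin_two]
  simp at h1
  linarith

theorem letter_periodic (P Q n : ℤ) (hQ : Q ≠ 0) : letter P Q (n + Q) = letter P Q n := by
  have h1 : (n + Q + 1) * P = (n + 1) * P + P * Q := by ring
  have h2 : (n + Q) * P = n * P + P * Q := by ring
  rw [letter, letter, h1, h2, Int.add_mul_ediv_right _ _ hQ, Int.add_mul_ediv_right _ _ hQ]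
  congr 1
  apply propext
  constructor <;> intro h <;> linarith

theorem letter_mod (P Q n : ℤ) (hQ : Q ≠ 0) : letter P Q (n % Q) = letter P Q n := by
  have hper : Function.Periodic (letter P Q) Q := fun n => letter_periodic P Q n hQ
  have := hper.int_mul (n / Q) (n % Q)
  rw [← this]
  congr 1
  have := Int.mul_ediv_add_emod n Q
  simp only [Int.cast_id]
  linarith

theorem periodic_trace {p q μ : ℝ} (hp : p ≠ 0) {Q : ℕ} [NeZero Q] (P r : ℤ)
    (φ : EuclideanSpace ℝ (ZMod Q)) (h0 : φ ≠ 0) (u : ZMod Q → Bool)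
    (hu : ∀ n : ℤ, u (n : ZMod Q) = letter P Q (n + r))
    (h : perOp p q u φ = μ • φ) : (Cmat (tmat p q μ) P Q).trace = 2 := by
  have hpc : ∀ b, pCoef p b ≠ 0 := by
    intro b
    cases b <;> simp [pCoef, hp]
  -- the vector of initial data
  set w : ℤ → Fin 2 → ℝ := fun n =>
    ![pCoef p (u ((n + 1 : ℤ) : ZMod Q)) * φ ((n + 1 : ℤ) : ZMod Q), φ (n : ZMod Q)] with hw
  have gen : ∀ (b : Bool) (x2 x1 x0 : ℝ), μ * x1 = x2 + pCoef p b * x0 + qCoef q b * x1 →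
      ![x2, x1] = (tmat p q μ b).mulVec ![pCoef p b * x1, x0] := by
    intro b x2 x1 x0 hh
    ext i
    fin_cases i
    · cases b
      · simp [tmat, pCoef, qCoef, Matrix.mulVec, dotProduct, Fin.sum_univ_two] at hh ⊢
        linarith
      · simp [tmat, pCoef, qCoef, Matrix.mulVec, dotProduct, Fin.sum_univ_two] at hh ⊢
        field_simp
        linarith
    · cases b
      · simp [tmat, pCoef, Matrix.mulVec, dotProduct, Fin.sum_univ_two]
      · simp [tmat, pCoef, Matrix.mulVec, dotProduct, Fin.sum_univ_two]
        field_simp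
  have hstep : ∀ n : ℤ, w (n + 1) = (tmat p q μ (u ((n + 1 : ℤ) : ZMod Q))).mulVec (w n) := by
    intro n
    have e : μ * φ ((n + 1 : ℤ) : ZMod Q) = pCoef p (u (((n + 1 : ℤ) : ZMod Q) + 1))
        * φ (((n + 1 : ℤ) : ZMod Q) + 1) + pCoef p (u ((n + 1 : ℤ) : ZMod Q))
        * φ (((n + 1 : ℤ) : ZMod Q) - 1) + qCoef q (u ((n + 1 : ℤ) : ZMod Q))
        * φ ((n + 1 : ℤ) : ZMod Q) := by
      rw [← perOp_apply, h]
      simp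
    have c1 : (((n + 1 : ℤ) : ZMod Q) + 1) = ((n + 1 + 1 : ℤ) : ZMod Q) := by push_cast; rfl
    have c2 : (((n + 1 : ℤ) : ZMod Q) - 1) = (n : ZMod Q) := by push_cast; ring
    rw [c1, c2] at e
    exact gen _ _ _ _ e
  have hprod : ∀ n : ℕ, w (-r - 1 + n)
      = (tmprod (tmat p q μ) (fun n : ℕ => letter P Q n) n).mulVec (w (-r - 1)) := by
    intro n
    induction n with
    | zero => simp [tmprod]
    | succ n ih =>
      rw [tmprod, ← Matrix.mulVec_mulVec, ← ih]
      push_cast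
      rw [← add_assoc, hstep, hu]
      congr 3
      ring
  have hC : (Cmat (tmat p q μ) P Q).mulVec (w (-r - 1)) = w (-r - 1) := by
    have := hprod Q
    rw [Cmat, Int.toNat_natCast, ← this]
    simp [hw]
  refine trace_eq_two _ (tmprod_det (tmat_det hp q μ) _ _) _ ?_ hC
  intro hz
  apply h0
  ext z
  have : z = ((-r - 1 + (((z + (r + 1 : ℤ) : ZMod Q)).val : ℕ) : ℤ) : ZMod Q) := by
    push_cast
    rw [ZMod.natCast_zmod_val]
    ring
  have h2 := hprod ((z + (r + 1 : ℤ) : ZMod Q)).val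
  rw [hz, Matrix.mulVec_zero] at h2
  have h3 := congrFun h2 1
  simp only [hw] at h3
  rw [← this] at h3
  simpa using h3

end

open Filter Topology

/-! ### Conclusion -/

theorem sturm_approx (α β : ℝ) (M : ℕ) : ∃ γ > 0, ∀ (P Q : ℤ), 0 < Q →
    2 * M * |α - (P : ℝ) / Q| + 1 / (Q : ℝ) < γ →
    ∃ b0 : ℤ, ∀ n : ℤ, |n| ≤ M → (n * P + b0) / Q = ⌊(n : ℝ) * α + β⌋ := by
  obtain ⟨n0, -, hmin⟩ := Finset.exists_min_image (Finset.Icc (-(M : ℤ)) M)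
    (fun n : ℤ => (⌊(n : ℝ) * α + β⌋ : ℝ) + 1 - ((n : ℝ) * α + β)) ⟨0, by simp⟩
  refine ⟨(⌊(n0 : ℝ) * α + β⌋ : ℝ) + 1 - ((n0 : ℝ) * α + β), by
    linarith [Int.lt_floor_add_one ((n0 : ℝ) * α + β)], ?_⟩
  intro P Q hQ hlt
  have hQ' : (0 : ℝ) < Q := by exact_mod_cast hQ
  set δ := |α - (P : ℝ) / Q| with hδ
  have hδ0 : 0 ≤ δ := abs_nonneg _
  refine ⟨⌈(Q : ℝ) * (β + M * δ)⌉, ?_⟩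
  intro n hn
  set b0 := ⌈(Q : ℝ) * (β + M * δ)⌉ with hb0
  have c1 : (Q : ℝ) * (β + M * δ) ≤ b0 := Int.le_ceil _
  have c2 : (b0 : ℝ) < (Q : ℝ) * (β + M * δ) + 1 := Int.ceil_lt_add_one _
  have hn' : |(n : ℝ)| ≤ M := by exact_mod_cast hn
  have hmn := hmin n (Finset.mem_Icc.2 (abs_le.1 hn))
  have d0 : |(n : ℝ) * (P / Q - α)| ≤ M * δ := by
    rw [abs_mul, hδ, abs_sub_comm]
    gcongr
  rw [abs_le] at d0
  have f1 := Int.floor_le ((n : ℝ) * α + β)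
  have e1 : (n : ℝ) * P = Q * (n * (P / Q - α)) + Q * (n * α) := by
    field_simp
    ring
  have e2 : (Q : ℝ) * (1 / Q) = 1 := by field_simp
  apply le_antisymm
  · refine Int.lt_add_one_iff.1 (Int.ediv_lt_of_lt_mul hQ ?_)
    have : (n : ℝ) * P + b0 < (⌊(n : ℝ) * α + β⌋ + 1) * Q := by
      have g1 : (Q : ℝ) * (2 * M * δ + 1 / Q)
          < Q * ((⌊(n : ℝ) * α + β⌋ : ℝ) + 1 - ((n : ℝ) * α + β)) :=
        mul_lt_mul_of_pos_left (lt_of_lt_of_le hlt hmn) hQ'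
      have g2 := mul_le_mul_of_nonneg_left d0.2 hQ'.le
      rw [mul_add, e2] at g1
      nlinarith
    exact_mod_cast this
  · refine Int.le_ediv_of_mul_le hQ ?_
    have : (⌊(n : ℝ) * α + β⌋ : ℝ) * Q ≤ (n : ℝ) * P + b0 := by
      have g2 := mul_le_mul_of_nonneg_left d0.1 hQ'.le
      have g3 := mul_le_mul_of_nonneg_left f1 hQ'.le
      nlinarith
    exact_mod_cast this

theorem spectrum_approx {v : ℤ → Bool} {α β : ℝ} (h0 : 0 < α) (h1 : α < 1) (hirr : Irrational α)
    (hv : ∀ n : ℤ, (v n = true ↔ Int.fract ((n : ℝ) * α + β) ∈ Set.Ico (1 - α) 1))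
    {p q : ℝ} (hp : p ≠ 0) (hp1 : |p| ≤ 1) {E : ℝ} (hE : E ∈ jacobiSpectrum p q v) {ε : ℝ}
    (hε : 0 < ε) (N₀ : ℕ) : ∃ N ≥ N₀, ∃ E' : ℝ, |E' - E| < ε ∧ |E'| ≤ 2 + |q| ∧
      ((polySt p q (sbDir α) N).1 * (polySt p q (sbDir α) N).2.1
        - (polySt p q (sbDir α) N).2.2).eval E' = 2 := by
  obtain ⟨N, f, hf0, hf⟩ := approx_real hE hε
  obtain ⟨γ, hγ, hst⟩ := sturm_approx α β (N + 3)
  obtain ⟨k1, hk1⟩ := exists_nat_gt ((2 * ((N + 3 : ℕ) : ℝ) + 1) / γ)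
  set k := max N₀ (max k1 (2 * N + 10)) with hk
  have hkN : N₀ ≤ k := le_max_left _ _
  have hkk : k1 ≤ k := (le_max_left _ _).trans (le_max_right _ _)
  have hkQ : 2 * N + 10 ≤ k := (le_max_right _ _).trans (le_max_right _ _)
  refine ⟨k, hkN, ?_⟩
  have hi := sb_inv h0 h1 hirr k
  have hmed := sb_mediant h0 h1 hirr k
  have htr := fun E' => (polySt_trace h0 h1 hirr hp q E' k).2.2
  obtain ⟨hb, hd, hdet, -, -, hsz⟩ := hi
  set a := (sb α k).1.1
  set b := (sb α k).1.2
  set c := (sb α k).2.1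
  set d := (sb α k).2.2
  obtain ⟨Q, hQe⟩ : ∃ Q : ℕ, b + d = Q := ⟨(b + d).toNat, by omega⟩
  rw [hQe] at hmed hsz
  simp only [hQe] at htr
  have hQ0 : 0 < Q := by omega
  haveI : NeZero Q := ⟨hQ0.ne'⟩
  have hkr : (0 : ℝ) < (k : ℝ) + 1 := by positivity
  have hsm : 2 * ((N + 3 : ℕ) : ℝ) * |α - ((a + c : ℤ) : ℝ) / ((Q : ℤ) : ℝ)| + 1 / ((Q : ℤ) : ℝ) < γ := by
    have q1 : 1 / ((Q : ℤ) : ℝ) ≤ 1 / (k + 1) := by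
      apply one_div_le_one_div_of_le hkr
      have : (k : ℤ) + 1 ≤ Q := by omega
      exact_mod_cast this
    have q2 : 2 * ((N + 3 : ℕ) : ℝ) * |α - ((a + c : ℤ) : ℝ) / ((Q : ℤ) : ℝ)|
        ≤ 2 * ((N + 3 : ℕ) : ℝ) * (1 / (k + 1)) :=
      mul_le_mul_of_nonneg_left hmed (by positivity)
    have q3 : (2 * ((N + 3 : ℕ) : ℝ) + 1) * (1 / ((k : ℝ) + 1)) < γ := by
      rw [mul_one_div, div_lt_iff₀ hkr]
      rw [div_lt_iff₀ hγ] at hk1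
      have : (k1 : ℝ) ≤ k := by exact_mod_cast hkk
      nlinarith
    linarith
  obtain ⟨b0, hb0⟩ := hst (a + c) Q (by exact_mod_cast hQ0) hsm
  have hQz : (Q : ℤ) ≠ 0 := by exact_mod_cast hQ0.ne'
  have hfl : ∀ n : ℤ, |n| ≤ ((N + 3 : ℕ) : ℤ) →
      (n + b0 * b) * (a + c) / (Q : ℤ) = ⌊(n : ℝ) * α + β⌋ + b0 * a := by
    intro n hn
    rw [← hb0 n hn]
    have : (n + b0 * b) * (a + c) = n * (a + c) + b0 + (b0 * a) * Q := by
      rw [← hQe]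
      linear_combination b0 * hdet
    rw [this, Int.add_mul_ediv_right _ _ hQz]
  have hlet : ∀ n : ℤ, |n| ≤ N + 2 → letter (a + c) Q (n + b0 * b) = v n := by
    intro n hn
    have hn' := abs_le.1 hn
    have l1 := hfl n (by push_cast; omega)
    have l2 := hfl (n + 1) (by rw [abs_le]; push_cast; omega)
    have l3 := letter_iff h0 h1 hv n
    have e : (n + b0 * b + 1) = (n + 1 + b0 * b) := by ring
    rw [letter, e, l1, l2, l3]
    cases hvn : v n <;> simp
    linarith
  set u : ZMod Q → Bool := fun z => letter (a + c) Q ((z.val : ℤ) + b0 * b) with hu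
  have hun : ∀ n : ℤ, u (n : ZMod Q) = letter (a + c) Q (n + b0 * b) := by
    intro n
    simp only [hu]
    rw [ZMod.val_intCast, ← letter_mod (a + c) Q (n % Q + b0 * b) hQz, Int.emod_add_emod,
      letter_mod (a + c) Q _ hQz]
  obtain ⟨μ, φ, hφ, hμ, hμE, hμb⟩ := periodic_eig hp1 hε hf0 hf (by omega : 2 * N + 10 ≤ Q) u
    (fun n hn => (hun n).trans (hlet n hn))
  refine ⟨μ, hμE, hμb, ?_⟩
  rw [← htr μ]
  exact periodic_trace hp (a + c) (b0 * b) φ hφ u hun hμ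

theorem final_bound (v : ℤ → Bool) (hv : IsSubstSeq v) (q : ℝ) :
    Tendsto (fun p : ℝ => dimH (jacobiSpectrum p q v)) (𝓝[≠] (0 : ℝ)) (𝓝 0) := by
  obtain ⟨s, hs, -, hfix, α, β, hirr, ⟨h0, h1⟩, hrot⟩ := hv
  obtain ⟨A, hA, hbad⟩ := alpha_badly h0 h1 hirr hs hrot hfix
  obtain ⟨K, hK0, hK1⟩ := sb_bounded h0 h1 hirr hA hbad
  rw [ENNReal.tendsto_nhds_zero]
  intro e he
  obtain ⟨t, ht0, hte⟩ := ENNReal.lt_iff_exists_nnreal_btwn.1 he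
  obtain ⟨δ, hδ, hδp⟩ := dim_bound (sbDir α) K hK0 hK1 q t (by exact_mod_cast ht0)
  have hev : ∀ᶠ p : ℝ in 𝓝[≠] (0 : ℝ), |p| < δ := by
    apply eventually_nhdsWithin_of_eventually_nhds
    have := Metric.ball_mem_nhds (0 : ℝ) hδ
    filter_upwards [this] with p hp
    simpa using hp
  filter_upwards [hev, self_mem_nhdsWithin] with p hp hp0
  obtain ⟨hp1, hS⟩ := hδp p hp0 hp
  refine (hS _ ?_).trans hte.le
  intro E hE ε hε N₀
  exact spectrum_approx h0 h1 hirr hrot hp0 hp1 hE hε N₀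

/-- in the decoupling limit `𝔭 → 0` (through `𝔭 ≠ 0`), the Hausdorff
dimension of the spectrum `Σ_{v,(𝔭,𝔮)}` tends to zero. -/
theorem hausdorff_dim_tendsto_zero (v : ℤ → Bool) (hv : IsSubstSeq v) (𝔮 : ℝ) :
    Tendsto (fun 𝔭 : ℝ => dimH (jacobiSpectrum 𝔭 𝔮 v)) (𝓝[≠] (0 : ℝ)) (𝓝 0) := by
  exact final_bound v hv 𝔮
end

section
/- Let 𝔭 ∈ ℝ∖{0}, 𝔮 ∈ ℝ, and let l_{(𝔭,𝔮)}(E) = ((E² − 𝔮E − 𝔭² − 1)/(2𝔭), (E − 𝔮)/(2𝔭), E/2) be the curve of initial conditions. Then for all E ∈ ℝ, I(l_{(𝔭,𝔮)}(E)) = (𝔮(𝔭² − 1)E + 𝔮² + (𝔭² − 1)²)/(4𝔭²); in particular E ↦ I(l_{(𝔭,𝔮)}(E)) is an affine function of E with slope 𝔮(𝔭² − 1)/(4𝔭²). Moreover, if 𝔮 ≠ 0 and 𝔭 ∉ {0, 1, −1}, then for every V ∈ ℝ there exists exactly one E ∈ ℝ with I(l_{(𝔭,𝔮)}(E)) = V,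 i.e. the curve l_{(𝔭,𝔮)} intersects every level surface S_V in exactly one point. -/
/-- The Fricke–Vogt invariant `I(x,y,z) = x² + y² + z² − 2xyz − 1`. -/
def FVinv (p : ℝ × ℝ × ℝ) : ℝ :=
  p.1 ^ 2 + p.2.1 ^ 2 + p.2.2 ^ 2 - 2 * p.1 * p.2.1 * p.2.2 - 1

/-- The curve of initial conditions
`l_{(𝔭,𝔮)}(E) = ((E² − 𝔮E − 𝔭² − 1)/(2𝔭), (E − 𝔮)/(2𝔭), E/2)`. -/
noncomputable def initCurve (𝔭 𝔮 E : ℝ) : ℝ × ℝ × ℝ :=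
  ((E ^ 2 - 𝔮 * E - 𝔭 ^ 2 - 1) / (2 * 𝔭), (E - 𝔮) / (2 * 𝔭), E / 2)

/-- `I(l_{(𝔭,𝔮)}(E)) = (𝔮(𝔭²−1)E + 𝔮² + (𝔭²−1)²)/(4𝔭²)`, an affine
function of `E` with slope `𝔮(𝔭²−1)/(4𝔭²)`; and if `𝔮 ≠ 0`, `𝔭 ∉ {0,1,−1}`, then
the curve meets every level surface `S_V` in exactly one point. -/
theorem initCurve_fricke_vogt (𝔭 𝔮 : ℝ) (h𝔭 : 𝔭 ≠ 0) :
    (∀ E : ℝ, FVinv (initCurve 𝔭 𝔮 E) =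
      (𝔮 * (𝔭 ^ 2 - 1) * E + 𝔮 ^ 2 + (𝔭 ^ 2 - 1) ^ 2) / (4 * 𝔭 ^ 2)) ∧
    (∀ E : ℝ, FVinv (initCurve 𝔭 𝔮 E) =
      FVinv (initCurve 𝔭 𝔮 0) + (𝔮 * (𝔭 ^ 2 - 1) / (4 * 𝔭 ^ 2)) * E) ∧
    (𝔮 ≠ 0 → 𝔭 ≠ 1 → 𝔭 ≠ -1 →
      ∀ V : ℝ, ∃! E : ℝ, FVinv (initCurve 𝔭 𝔮 E) = V) := by
  have key : ∀ E : ℝ, FVinv (initCurve 𝔭 𝔮 E) =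
      (𝔮 * (𝔭 ^ 2 - 1) * E + 𝔮 ^ 2 + (𝔭 ^ 2 - 1) ^ 2) / (4 * 𝔭 ^ 2) := by
    intro E
    simp only [FVinv, initCurve]
    field_simp
    ring
  refine ⟨key, ?_, ?_⟩
  · intro E
    rw [key, key]
    ring
  · intro hq h1 h2 V
    have hp : 𝔭 ^ 2 - 1 ≠ 0 := by
      intro h
      have h3 : (𝔭 - 1) * (𝔭 + 1) = 0 := by linarith
      rcases mul_eq_zero.mp h3 with h4 | h4
      · exact h1 (by linarith)
      · exact h2 (by linarith)
    have hs : 𝔮 * (𝔭 ^ 2 - 1) ≠ 0 := mul_ne_zero hq hp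
    have hd : 4 * 𝔭 ^ 2 ≠ 0 := by positivity
    refine ⟨(V * (4 * 𝔭 ^ 2) - 𝔮 ^ 2 - (𝔭 ^ 2 - 1) ^ 2) / (𝔮 * (𝔭 ^ 2 - 1)), ?_, ?_⟩
    · show FVinv (initCurve 𝔭 𝔮 _) = V
      rw [key, div_eq_iff hd, mul_div_cancel₀ _ hs]
      ring
    · intro E hE
      have hE' : FVinv (initCurve 𝔭 𝔮 E) = V := hE
      rw [key, div_eq_iff hd] at hE'
      rw [eq_div_iff hs]
      linarith
end

section
/- For every positive integer a, the map t_a = U^a ∘ P, where U(x,y,z) = (2xz − y, x, z) and P(x,y,z) = (x, z, y), fixes the point P₁ = (1,1,1), and the Jacobian matrix of t_a at (1,1,1) has three real eigenvalues λ, ν, μ with |λ| < 1, |ν| = 1 (ν = 1 or ν = −1), and |μ| > 1. -/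
/-- `U(x,y,z) = (2xz − y, x, z)`. -/
def Umap (p : ℝ × ℝ × ℝ) : ℝ × ℝ × ℝ := (2 * p.1 * p.2.2 - p.2.1, p.1, p.2.2)

/-- `P(x,y,z) = (x, z, y)`. -/
def Pmap (p : ℝ × ℝ × ℝ) : ℝ × ℝ × ℝ := (p.1, p.2.2, p.2.1)

/-- `t_a = U^a ∘ P`. -/
def tMap (a : ℕ) : ℝ × ℝ × ℝ → ℝ × ℝ × ℝ := Umap^[a] ∘ Pmap

/-- The derivative of `Umap` at `(1,1,1)`. -/
noncomputable def LU : (ℝ × ℝ × ℝ) →L[ℝ] (ℝ × ℝ × ℝ) :=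
  ((2 : ℝ) • ContinuousLinearMap.fst ℝ ℝ (ℝ × ℝ)
    + (2 : ℝ) • (ContinuousLinearMap.snd ℝ ℝ ℝ).comp (ContinuousLinearMap.snd ℝ ℝ (ℝ × ℝ))
    - (ContinuousLinearMap.fst ℝ ℝ ℝ).comp (ContinuousLinearMap.snd ℝ ℝ (ℝ × ℝ))).prod
  ((ContinuousLinearMap.fst ℝ ℝ (ℝ × ℝ)).prod
    ((ContinuousLinearMap.snd ℝ ℝ ℝ).comp (ContinuousLinearMap.snd ℝ ℝ (ℝ × ℝ))))

/-- `Pmap` as a continuous linear map. -/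
noncomputable def LP : (ℝ × ℝ × ℝ) →L[ℝ] (ℝ × ℝ × ℝ) :=
  (ContinuousLinearMap.fst ℝ ℝ (ℝ × ℝ)).prod
    (((ContinuousLinearMap.snd ℝ ℝ ℝ).comp (ContinuousLinearMap.snd ℝ ℝ (ℝ × ℝ))).prod
     ((ContinuousLinearMap.fst ℝ ℝ ℝ).comp (ContinuousLinearMap.snd ℝ ℝ (ℝ × ℝ))))

lemma LU_apply (x y z : ℝ) : LU (x, y, z) = (2 * x + 2 * z - y, x, z) := by
  simp [LU]

lemma LP_apply (x y z : ℝ) : LP (x, y, z) = (x, z, y) := by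
  simp [LP]

lemma LU_pow_apply (n : ℕ) (x y z : ℝ) : (LU ^ n) (x, y, z) =
    (x + n * (x - y) + n * (n + 1) * z, x + (n - 1) * (x - y) + n * (n - 1) * z, z) := by
  induction n with
  | zero => simp
  | succ k ih =>
    rw [pow_succ', ContinuousLinearMap.mul_apply, ih, LU_apply]
    push_cast
    refine Prod.ext ?_ (Prod.ext ?_ rfl)
    · dsimp only
      ring
    · dsimp only
      ring

lemma hasFDerivAt_Umap : HasFDerivAt Umap LU ((1 : ℝ), (1 : ℝ), (1 : ℝ)) := by
  have h1 : HasFDerivAt (fun p : ℝ × ℝ × ℝ => p.1)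
      (ContinuousLinearMap.fst ℝ ℝ (ℝ × ℝ)) ((1 : ℝ), (1 : ℝ), (1 : ℝ)) := hasFDerivAt_fst
  have h0 : HasFDerivAt (fun p : ℝ × ℝ × ℝ => p.2)
      (ContinuousLinearMap.snd ℝ ℝ (ℝ × ℝ)) ((1 : ℝ), (1 : ℝ), (1 : ℝ)) := hasFDerivAt_snd
  have h2 := h0.fst
  have h3 := h0.snd
  have h := (((h1.const_mul 2).mul h3).sub h2).prodMk (h1.prodMk h3)
  refine h.congr_fderiv ?_
  ext <;> simp [LU]

lemma Umap_fix : Umap ((1 : ℝ), (1 : ℝ), (1 : ℝ)) = (1, 1, 1) := by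
  ext <;> norm_num [Umap]

lemma Pmap_fix : Pmap ((1 : ℝ), (1 : ℝ), (1 : ℝ)) = (1, 1, 1) := rfl

lemma hasFDerivAt_tMap (a : ℕ) :
    HasFDerivAt (tMap a) ((LU ^ a).comp LP) ((1 : ℝ), (1 : ℝ), (1 : ℝ)) := by
  have hP : HasFDerivAt Pmap LP ((1 : ℝ), (1 : ℝ), (1 : ℝ)) := LP.hasFDerivAt
  have hU := hasFDerivAt_Umap.iterate Umap_fix a
  exact HasFDerivAt.comp (g := Umap^[a]) _ (by rw [Pmap_fix]; exact hU) hP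

lemma eig (a : ℕ) (ha : 0 < a) (l : ℝ)
    (hl : (l + 1) * (l ^ 2 - ((a : ℝ) ^ 2 + 2) * l + 1) = 0) :
    Module.End.HasEigenvalue
        ((fderiv ℝ (tMap a) ((1 : ℝ), (1 : ℝ), (1 : ℝ))).toLinearMap) l := by
  have ha' : (a : ℝ) ≠ 0 := by positivity
  rw [(hasFDerivAt_tMap a).fderiv]
  refine Module.End.hasEigenvalue_of_hasEigenvector
    (x := ((l ^ 2 + (a - 1) - a * (a - 1) * l) / a, l, 1)) ⟨?_, ?_⟩
  · rw [Module.End.mem_eigenspace_iff]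
    change (LU ^ a) (LP _) = _
    rw [LP_apply, LU_pow_apply]
    ext
    · simp
      field_simp
      linear_combination -hl
    · simp
      field_simp
      ring
    · simp
  · intro h
    simp at h

/-- for every positive integer `a`, `t_a` fixes `P₁ = (1,1,1)` and its
Jacobian (the derivative, as an endomorphism of `ℝ³`) at `(1,1,1)` has three real
eigenvalues `λ, ν, μ` with `|λ| < 1`, `ν = ±1`, `|μ| > 1`. -/
theorem tMap_fixes_and_partially_hyperbolic (a : ℕ) (ha : 0 < a) :
    tMap a ((1 : ℝ), (1 : ℝ), (1 : ℝ)) = (1, 1, 1) ∧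
    ∃ lam nu mu : ℝ,
      Module.End.HasEigenvalue
        ((fderiv ℝ (tMap a) ((1 : ℝ), (1 : ℝ), (1 : ℝ))).toLinearMap) lam ∧
      Module.End.HasEigenvalue
        ((fderiv ℝ (tMap a) ((1 : ℝ), (1 : ℝ), (1 : ℝ))).toLinearMap) nu ∧
      Module.End.HasEigenvalue
        ((fderiv ℝ (tMap a) ((1 : ℝ), (1 : ℝ), (1 : ℝ))).toLinearMap) mu ∧
      |lam| < 1 ∧ (nu = 1 ∨ nu = -1) ∧ 1 < |mu| := by
  refine ⟨?_, ?_⟩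
  · have h : Umap^[a] ((1 : ℝ), (1 : ℝ), (1 : ℝ)) = (1, 1, 1) :=
      Function.iterate_fixed Umap_fix a
    simpa [tMap, Pmap_fix] using h
  have ha1 : (1 : ℝ) ≤ a := by exact_mod_cast ha
  obtain ⟨s, hs⟩ : ∃ s : ℝ, s = (a : ℝ) ^ 2 + 2 := ⟨_, rfl⟩
  have hs3 : 3 ≤ s := by nlinarith
  have hd : √(s ^ 2 - 4) ^ 2 = s ^ 2 - 4 := Real.sq_sqrt (by nlinarith)
  have hd0 := Real.sqrt_nonneg (s ^ 2 - 4)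
  set d := √(s ^ 2 - 4)
  have hlt : d < s := by nlinarith
  have hgt : s - 2 < d := by nlinarith
  refine ⟨(s - d) / 2, -1, (s + d) / 2, eig a ha _ ?_, eig a ha _ ?_, eig a ha _ ?_, ?_,
    Or.inr rfl, ?_⟩
  · rw [← hs]
    linear_combination ((s - d) / 2 + 1) / 4 * hd
  · ring
  · rw [← hs]
    linear_combination ((s + d) / 2 + 1) / 4 * hd
  · rw [abs_lt]
    constructor <;> linarith
  · rw [lt_abs]
    left
    linarith
end

section
/- Let 𝓗 be a complex Hilbert space, let H and H_k (k ∈ ℕ) be bounded self-adjoint operators on 𝓗, and suppose H_k → H strongly (i.e. H_kφ → Hφ for every φ ∈ 𝓗). Then the spectra satisfy the semicontinuity inclusion σ(H) ⊆ ⋂_{l∈ℕ} closure( ⋃_{k≥l} σ(H_k) ). -/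
open Filter Topology

lemma aux_lower_bound {𝓗 : Type*} [NormedAddCommGroup 𝓗] [InnerProductSpace ℂ 𝓗] [CompleteSpace 𝓗]
    (T : 𝓗 →L[ℂ] 𝓗) (hT : IsSelfAdjoint T) (z : ℂ) (ε : ℝ) (hε : 0 < ε)
    (h : ∀ x ∈ spectrum ℂ T, ε ≤ ‖z - x‖) (φ : 𝓗) : ε * ‖φ‖ ≤ ‖z • φ - T φ‖ := by
  have hn : IsStarNormal T := hT.isStarNormal
  have hne : ∀ x ∈ spectrum ℂ T, z - x ≠ 0 := fun x hx h0 => by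
    have := h x hx
    rw [h0, norm_zero] at this
    linarith
  have hc : ContinuousOn (fun x : ℂ => (z - x)⁻¹) (spectrum ℂ T) :=
    ContinuousOn.inv₀ (by fun_prop) hne
  have h1 : cfc (fun x : ℂ => (z - x)⁻¹) T * cfc (fun x : ℂ => z - x) T = 1 := by
    rw [← cfc_mul (fun x : ℂ => (z - x)⁻¹) (fun x : ℂ => z - x) T hc (by fun_prop),
      ← cfc_one ℂ T]
    exact cfc_congr fun x hx => inv_mul_cancel₀ (hne x hx)
  have h2 : cfc (fun x : ℂ => z - x) T = algebraMap ℂ _ z - T := by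
    rw [cfc_sub (fun _ : ℂ => z) (fun x => x) T, cfc_const z T, cfc_id' ℂ T]
  have h3 : ‖cfc (fun x : ℂ => (z - x)⁻¹) T‖ ≤ ε⁻¹ := by
    refine norm_cfc_le (by positivity) fun x hx => ?_
    rw [norm_inv]
    exact inv_anti₀ hε (h x hx)
  rw [h2] at h1
  have h4 : cfc (fun x : ℂ => (z - x)⁻¹) T (z • φ - T φ) = φ := by
    have := congrArg (fun S : 𝓗 →L[ℂ] 𝓗 => S φ) h1
    simpa [Algebra.algebraMap_eq_smul_one] using this
  have h5 : ‖φ‖ ≤ ε⁻¹ * ‖z • φ - T φ‖ := by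
    conv_lhs => rw [← h4]
    exact ContinuousLinearMap.le_of_opNorm_le _ h3 _
  rwa [← div_eq_inv_mul, le_div_iff₀ hε, mul_comm] at h5

lemma aux_isUnit {𝓗 : Type*} [NormedAddCommGroup 𝓗] [InnerProductSpace ℂ 𝓗] [CompleteSpace 𝓗]
    (A : 𝓗 →L[ℂ] 𝓗) (hA : IsStarNormal A) (ε : ℝ) (hε : 0 < ε)
    (h : ∀ φ, ε * ‖φ‖ ≤ ‖A φ‖) : IsUnit A := by
  have h1 : IsUnit (star A * A) := by
    refine ContinuousLinearMap.isUnit_of_forall_le_norm_inner_map _ (c := ⟨ε ^ 2, by positivity⟩)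
      (pow_pos hε 2) fun x => ?_
    have : inner ℂ ((star A * A) x) x = ((‖A x‖ ^ 2 : ℝ) : ℂ) := by
      rw [ContinuousLinearMap.mul_apply, ContinuousLinearMap.star_eq_adjoint,
        ContinuousLinearMap.adjoint_inner_left, inner_self_eq_norm_sq_to_K]
      simp
    rw [this, Complex.norm_real, Real.norm_of_nonneg (by positivity)]
    change ‖x‖ ^ 2 * ε ^ 2 ≤ _
    rw [← mul_pow, mul_comm]
    exact pow_le_pow_left₀ (by positivity) (h x) 2
  exact ((hA.star_comm_self).isUnit_mul_iff.mp h1).2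

/-- if bounded self-adjoint operators `H_k` on a complex Hilbert space
converge strongly to a bounded self-adjoint `H`, then
`σ(H) ⊆ ⋂_l closure(⋃_{k ≥ l} σ(H_k))`. -/
theorem spectrum_semicontinuous_of_strong_limit
    {𝓗 : Type*} [NormedAddCommGroup 𝓗] [InnerProductSpace ℂ 𝓗] [CompleteSpace 𝓗]
    (H : 𝓗 →L[ℂ] 𝓗) (Hk : ℕ → 𝓗 →L[ℂ] 𝓗)
    (hH : IsSelfAdjoint H) (hHk : ∀ k, IsSelfAdjoint (Hk k))
    (hconv : ∀ φ : 𝓗, Tendsto (fun k => Hk k φ) atTop (𝓝 (H φ))) :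
    spectrum ℂ H ⊆ ⋂ l : ℕ, closure (⋃ k : ℕ, ⋃ (_ : l ≤ k), spectrum ℂ (Hk k)) := by
  intro z hz
  rw [Set.mem_iInter]
  intro l
  by_contra hcl
  rw [Metric.mem_closure_iff] at hcl
  push Not at hcl
  obtain ⟨ε, hε, hd⟩ := hcl
  have hb : ∀ φ : 𝓗, ε * ‖φ‖ ≤ ‖z • φ - H φ‖ := fun φ => by
    refine ge_of_tendsto ((tendsto_const_nhds.sub (hconv φ)).norm) ?_
    filter_upwards [eventually_ge_atTop l] with k hk
    refine aux_lower_bound (Hk k) (hHk k) z ε hε (fun x hx => ?_) φ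
    rw [← dist_eq_norm]
    exact hd x (by simp only [Set.mem_iUnion]; exact ⟨k, hk, hx⟩)
  refine hz (aux_isUnit _ ?_ ε hε fun φ => ?_)
  · refine ⟨?_⟩
    rw [star_sub, hH.star_eq, ← algebraMap_star_comm]
    exact ((Algebra.commute_algebraMap_left _ _).sub_left
      ((Algebra.commute_algebraMap_right _ _).sub_right (Commute.refl _)))
  · simpa [Algebra.algebraMap_eq_smul_one] using hb φ
end
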